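/- arXiv:2405.11763 — 6 statements merged into one kernel-verified Lean document; each statement's English description precedes it below -/
import Mathlib

section
/- Let p > 1, 0 < γ < p − 1, 0 < ε₀ < 1, and x₀ ∈ ℝ. Let S₁ = {k ∈ ℂ : −γ/2 ≤ Im k ≤ 1 − ε₀}. Then there exist ε₁ > 0, C > 0 and a function f₁ : ℝ × S₁ → ℂ², f₁ = (f₁¹, f₁²), such that for every k ∈ S₁: (i) x ↦ f₁(x,k) is twice continuously differentiable and satisfies for all x ∈ ℝ the system −∂_x²f₁¹ + f₁¹ − ((p+1)/2)φ_p^{p−1}f₁¹ − ((p−1)/2)φ_p^{p−1}f₁² = (k²+1)f₁¹ and ∂_x²f₁² − f₁² + ((p−1)/2)φ_p^{p−1}f₁¹ + ((p+1)/2)φ_p^{p−1}f₁² = (k²+1)f₁²; (ii) the function m₁(x,k) := e^{−ikx}·f₁(x,k) satisfies |m₁(x,k) − (1,0)| ≤ C(1+|k|)^{−1}e^{−ε₁x} and |∂_x m₁(x,k)| ≤ C·e^{−ε₁x} for all x ≥ x₀. -/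
/-- The ground state `φ_p` of the pure power NLS on the line. -/
noncomputable def groundState (p x : ℝ) : ℝ :=
  ((p + 1) / 2) ^ (1 / (p - 1)) * (1 / Real.cosh ((p - 1) * x / 2)) ^ (2 / (p - 1))

/-! ### First order integral operators -/

/-- The solution of `u' = λ u + g` obtained by integrating from `+∞`. -/
noncomputable def bwdSol (l : ℂ) (g : ℝ → ℂ) (x : ℝ) : ℂ :=
  -(Complex.exp (l * x) * ∫ y : ℝ in Set.Ioi x, Complex.exp (-(l * y)) * g y)

/-- The solution of `u' = λ u + g` vanishing at `a`. -/
noncomputable def fwdSol (a : ℝ) (l : ℂ) (g : ℝ → ℂ) (x : ℝ) : ℂ :=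
  Complex.exp (l * x) * ∫ y in a..x, Complex.exp (-(l * y)) * g y

/-- `g` is bounded by a combination of two exponentials centred at `a`. -/
def ExpBdd (a τ L : ℝ) (g : ℝ → ℂ) (A B : ℝ) : Prop :=
  ∀ y, ‖g y‖ ≤ A * Real.exp (-τ * (y - a)) + B * Real.exp (-L * (y - a))

theorem hasDerivAt_cexp_mul (l : ℂ) (x : ℝ) :
    HasDerivAt (fun y : ℝ => Complex.exp (l * y)) (l * Complex.exp (l * x)) x := by
  have h : HasDerivAt (fun y : ℝ => l * (y : ℂ)) l x := by
    simpa using (Complex.ofRealCLM.hasDerivAt (x := x)).const_mul l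
  simpa [mul_comm] using h.cexp

theorem norm_cexp_mul_ofReal (l : ℂ) (x : ℝ) :
    ‖Complex.exp (l * x)‖ = Real.exp (l.re * x) := by
  simp [Complex.norm_exp]

theorem norm_cexp_neg_mul_ofReal (l : ℂ) (x : ℝ) :
    ‖Complex.exp (-(l * x))‖ = Real.exp (-(l.re * x)) := by
  simp [Complex.norm_exp]

theorem continuous_cexp_neg_mul {g : ℝ → ℂ} (hg : Continuous g) (l : ℂ) :
    Continuous fun y : ℝ => Complex.exp (-(l * y)) * g y := by fun_prop

theorem norm_kernel_le {a τ L A B : ℝ} {g : ℝ → ℂ} (h : ExpBdd a τ L g A B) (l : ℂ) (y : ℝ) :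
    ‖Complex.exp (-(l * y)) * g y‖ ≤
      A * Real.exp (τ * a) * Real.exp (-(l.re + τ) * y)
        + B * Real.exp (L * a) * Real.exp (-(l.re + L) * y) := by
  rw [norm_mul, norm_cexp_neg_mul_ofReal]
  refine (mul_le_mul_of_nonneg_left (h y) (Real.exp_pos _).le).trans (le_of_eq ?_)
  rw [mul_assoc A, mul_assoc B, ← Real.exp_add, ← Real.exp_add, mul_add, mul_left_comm,
    mul_left_comm _ B, ← Real.exp_add, ← Real.exp_add]
  congr 3 <;> ring_nf

section bwd

variable {a τ L A B : ℝ} {g : ℝ → ℂ} {l : ℂ}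

theorem integrableOn_majorant (hτ : 0 < l.re + τ) (hL : 0 < l.re + L) (x : ℝ) :
    MeasureTheory.IntegrableOn (fun y => A * Real.exp (τ * a) * Real.exp (-(l.re + τ) * y)
        + B * Real.exp (L * a) * Real.exp (-(l.re + L) * y)) (Set.Ioi x) :=
  ((integrableOn_exp_mul_Ioi (by linarith) x).const_mul _).add
    ((integrableOn_exp_mul_Ioi (by linarith) x).const_mul _)

theorem ExpBdd.integrableOn (h : ExpBdd a τ L g A B) (hg : Continuous g)
    (hτ : 0 < l.re + τ) (hL : 0 < l.re + L) (x : ℝ) :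
    MeasureTheory.IntegrableOn (fun y : ℝ => Complex.exp (-(l * y)) * g y) (Set.Ioi x) :=
  (integrableOn_majorant hτ hL x).mono'
    (continuous_cexp_neg_mul hg l).aestronglyMeasurable
    (Filter.Eventually.of_forall (norm_kernel_le h l))

theorem ExpBdd.norm_bwdSol_le (h : ExpBdd a τ L g A B)
    (hτ : 0 < l.re + τ) (hL : 0 < l.re + L) (x : ℝ) :
    ‖bwdSol l g x‖ ≤ A / (l.re + τ) * Real.exp (-τ * (x - a))
      + B / (l.re + L) * Real.exp (-L * (x - a)) := by
  rw [bwdSol, norm_neg, norm_mul, norm_cexp_mul_ofReal]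
  have key := MeasureTheory.norm_integral_le_of_norm_le
    (integrableOn_majorant (a := a) (A := A) (B := B) hτ hL x)
    (Filter.Eventually.of_forall (norm_kernel_le h l))
  refine (mul_le_mul_of_nonneg_left key (Real.exp_pos _).le).trans (le_of_eq ?_)
  rw [MeasureTheory.integral_add ((integrableOn_exp_mul_Ioi (by linarith) x).const_mul _)
    ((integrableOn_exp_mul_Ioi (by linarith) x).const_mul _),
    MeasureTheory.integral_const_mul, MeasureTheory.integral_const_mul,
    integral_exp_mul_Ioi (by linarith), integral_exp_mul_Ioi (by linarith)]
  have e1 : Real.exp (-τ * (x - a)) =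
      Real.exp (l.re * x) * Real.exp (τ * a) * Real.exp (-(l.re + τ) * x) := by
    rw [← Real.exp_add, ← Real.exp_add]; ring_nf
  have e2 : Real.exp (-L * (x - a)) =
      Real.exp (l.re * x) * Real.exp (L * a) * Real.exp (-(l.re + L) * x) := by
    rw [← Real.exp_add, ← Real.exp_add]; ring_nf
  rw [e1, e2, neg_div_neg_eq, neg_div_neg_eq]
  field_simp

theorem ExpBdd.expBdd_bwdSol {α : ℝ} (h : ExpBdd a τ L g A B) (hA : 0 ≤ A) (hB : 0 ≤ B)
    (hl : -α ≤ l.re) (hτ : α < τ) (hL : α < L) :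
    ExpBdd a τ L (bwdSol l g) (A / (τ - α)) (B / (L - α)) := by
  intro x
  refine (h.norm_bwdSol_le (l := l) (by linarith) (by linarith) x).trans ?_
  gcongr <;> linarith

theorem ExpBdd.hasDerivAt_bwdSol (h : ExpBdd a τ L g A B) (hg : Continuous g)
    (hτ : 0 < l.re + τ) (hL : 0 < l.re + L) (x : ℝ) :
    HasDerivAt (bwdSol l g) (l * bwdSol l g x + g x) x := by
  have hc := continuous_cexp_neg_mul hg l
  have hI : (fun x : ℝ => ∫ y : ℝ in Set.Ioi x, Complex.exp (-(l * y)) * g y) = fun x =>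
      (∫ y : ℝ in Set.Ioi 0, Complex.exp (-(l * y)) * g y)
        - ∫ y in (0 : ℝ)..x, Complex.exp (-(l * y)) * g y := by
    funext z
    rw [← intervalIntegral.integral_interval_add_Ioi (h.integrableOn hg hτ hL 0)
      (h.integrableOn hg hτ hL z)]
    ring
  have hd := (intervalIntegral.integral_hasDerivAt_right (hc.intervalIntegrable 0 x)
    (hc.stronglyMeasurableAtFilter _ _) hc.continuousAt).const_sub
      (∫ y : ℝ in Set.Ioi 0, Complex.exp (-(l * y)) * g y)
  rw [← hI] at hd
  have := ((hasDerivAt_cexp_mul l x).mul hd).neg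
  refine this.congr_deriv ?_
  have hinv : Complex.exp (l * x) * Complex.exp (-(l * x)) = 1 := by
    rw [← Complex.exp_add]; simp
  simp only [bwdSol]
  linear_combination g x * hinv

theorem ExpBdd.bwdSol_sub {g' : ℝ → ℂ} {A' B' : ℝ} (h : ExpBdd a τ L g A B) (hg : Continuous g)
    (h' : ExpBdd a τ L g' A' B') (hg' : Continuous g')
    (hτ : 0 < l.re + τ) (hL : 0 < l.re + L) :
    bwdSol l (g - g') = bwdSol l g - bwdSol l g' := by
  funext x
  simp only [bwdSol, Pi.sub_apply, mul_sub]
  rw [MeasureTheory.integral_sub (h.integrableOn hg hτ hL x) (h'.integrableOn hg' hτ hL x)]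
  ring

/-- Partial fractions: `λ ∂⁻¹ (∂ - λ)⁻¹ = (∂ - λ)⁻¹ - ∂⁻¹`. -/
theorem ExpBdd.mul_bwdSol_zero_bwdSol {α : ℝ} (h : ExpBdd a τ L g A B) (hg : Continuous g)
    (hA : 0 ≤ A) (hB : 0 ≤ B) (hα : 0 ≤ α)
    (hl : -α ≤ l.re) (hτ : α < τ) (hL : α < L) (x : ℝ) :
    l * bwdSol 0 (bwdSol l g) x
      = bwdSol l g x - bwdSol 0 g x := by
  have hd := h.hasDerivAt_bwdSol (l := l) hg (by linarith) (by linarith)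
  have hv := h.expBdd_bwdSol hA hB hl hτ hL
  have hvc : Continuous (bwdSol l g) :=
    continuous_iff_continuousAt.2 fun y => (hd y).continuousAt
  have z1 : 0 < (0 : ℂ).re + τ := by simp; linarith
  have z2 : 0 < (0 : ℂ).re + L := by simp; linarith
  have i1 : MeasureTheory.IntegrableOn (bwdSol l g) (Set.Ioi x) := by
    simpa using hv.integrableOn hvc z1 z2 x
  have i2 : MeasureTheory.IntegrableOn g (Set.Ioi x) := by
    simpa using h.integrableOn hg z1 z2 x
  have decay : ∀ s : ℝ, 0 < s →
      Filter.Tendsto (fun y => Real.exp (-s * (y - a))) Filter.atTop (nhds 0) := by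
    intro s hs
    refine Real.tendsto_exp_atBot.comp ?_
    exact (Filter.tendsto_atTop_add_const_right _ (-a) Filter.tendsto_id).const_mul_atTop_of_neg
      (by linarith)
  have ht : Filter.Tendsto (bwdSol l g) Filter.atTop (nhds 0) := by
    refine squeeze_zero_norm hv ?_
    simpa using ((decay τ (by linarith)).const_mul _).add ((decay L (by linarith)).const_mul _)
  have key := MeasureTheory.integral_Ioi_of_hasDerivAt_of_tendsto' (a := x)
    (fun y _ => hd y) ((i1.const_mul l).add i2) ht
  rw [MeasureTheory.integral_add (i1.const_mul l) i2, MeasureTheory.integral_const_mul] at key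
  have e : ∀ q : ℝ → ℂ, bwdSol 0 q x = -∫ y in Set.Ioi x, q y := by
    intro q; simp [bwdSol]
  rw [e, e]
  linear_combination -key

end bwd

theorem hasDerivAt_fwdSol (a : ℝ) (l : ℂ) {g : ℝ → ℂ} (hg : Continuous g) (x : ℝ) :
    HasDerivAt (fwdSol a l g) (l * fwdSol a l g x + g x) x := by
  have hc := continuous_cexp_neg_mul hg l
  have hd := intervalIntegral.integral_hasDerivAt_right (hc.intervalIntegrable a x)
    (hc.stronglyMeasurableAtFilter _ _) hc.continuousAt
  refine ((hasDerivAt_cexp_mul l x).mul hd).congr_deriv ?_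
  have hinv : Complex.exp (l * x) * Complex.exp (-(l * x)) = 1 := by
    rw [← Complex.exp_add]; simp
  simp only [fwdSol]
  linear_combination g x * hinv

theorem fwdSol_sub (a : ℝ) (l : ℂ) {g g' : ℝ → ℂ} (hg : Continuous g) (hg' : Continuous g') :
    fwdSol a l (g - g') = fwdSol a l g - fwdSol a l g' := by
  funext x
  simp only [fwdSol, Pi.sub_apply, mul_sub]
  rw [intervalIntegral.integral_sub ((continuous_cexp_neg_mul hg l).intervalIntegrable a x)
    ((continuous_cexp_neg_mul hg' l).intervalIntegrable a x), mul_sub]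

/-- The weight `max (e^{-δ t}) (e^{-L t})`. -/
noncomputable def expWeight (δ L t : ℝ) : ℝ := max (Real.exp (-δ * t)) (Real.exp (-L * t))

theorem expWeight_pos (δ L t : ℝ) : 0 < expWeight δ L t :=
  lt_max_of_lt_left (Real.exp_pos _)

theorem continuous_expWeight (δ L a : ℝ) : Continuous fun x => expWeight δ L (x - a) := by
  unfold expWeight; fun_prop

theorem exp_le_expWeight {δ τ L : ℝ} (h1 : δ ≤ τ) (h2 : τ ≤ L) (t : ℝ) :
    Real.exp (-τ * t) ≤ expWeight δ L t := by
  rcases le_total 0 t with ht | ht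
  · exact le_max_of_le_left (Real.exp_le_exp.2 (by nlinarith))
  · exact le_max_of_le_right (Real.exp_le_exp.2 (by nlinarith))

theorem expWeight_of_nonneg {δ L t : ℝ} (h : δ ≤ L) (ht : 0 ≤ t) :
    expWeight δ L t = Real.exp (-δ * t) :=
  max_eq_left (Real.exp_le_exp.2 (by nlinarith))

theorem expWeight_of_nonpos {δ L t : ℝ} (h : δ ≤ L) (ht : t ≤ 0) :
    expWeight δ L t = Real.exp (-L * t) :=
  max_eq_right (Real.exp_le_exp.2 (by nlinarith))

theorem norm_integral_le_sub_of_hasDerivAt {h : ℝ → ℂ} {G G' : ℝ → ℝ} {u v : ℝ} (huv : u ≤ v)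
    (hG : ∀ y, HasDerivAt G (G' y) y) (hG' : Continuous G')
    (hle : ∀ y, u ≤ y → y ≤ v → ‖h y‖ ≤ G' y) :
    ‖∫ y in u..v, h y‖ ≤ G v - G u := by
  rw [← intervalIntegral.integral_eq_sub_of_hasDerivAt (fun y _ => hG y)
    (hG'.intervalIntegrable u v)]
  exact intervalIntegral.norm_integral_le_of_norm_le huv
    (Filter.Eventually.of_forall fun y hy => hle y hy.1.le hy.2) (hG'.intervalIntegrable u v)

theorem hasDerivAt_exp_sub (c a s y : ℝ) :
    HasDerivAt (fun y => c * Real.exp (s * (y - a))) (c * s * Real.exp (s * (y - a))) y := by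
  have := ((((hasDerivAt_id y).sub_const a).const_mul s).exp).const_mul c
  refine this.congr_deriv ?_
  simp; ring

theorem norm_fwdSol_le {a δ L N c : ℝ} {l : ℂ} {g : ℝ → ℂ} (hN : 0 ≤ N) (hc : 0 < c)
    (hδL : δ ≤ L)
    (h1 : c ≤ -l.re - δ) (h2 : c ≤ L + l.re)
    (hb : ∀ y, ‖g y‖ ≤ N * expWeight δ L (y - a)) (x : ℝ) :
    ‖fwdSol a l g x‖ ≤ N / c * expWeight δ L (x - a) := by
  rw [fwdSol, norm_mul, norm_cexp_mul_ofReal]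
  rcases le_total a x with hx | hx
  · set s := -l.re - δ with hs
    have hs0 : 0 < s := by linarith
    have key : ‖∫ y in a..x, Complex.exp (-(l * y)) * g y‖ ≤
        N * Real.exp (-l.re * a) / s * Real.exp (s * (x - a))
          - N * Real.exp (-l.re * a) / s * Real.exp (s * (a - a)) := by
      refine norm_integral_le_sub_of_hasDerivAt hx
        (G := fun y => N * Real.exp (-l.re * a) / s * Real.exp (s * (y - a)))
        (hasDerivAt_exp_sub _ a s) (by fun_prop) ?_
      intro y hy _
      rw [norm_mul, norm_cexp_neg_mul_ofReal]
      have := hb y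
      rw [expWeight_of_nonneg hδL (by linarith)] at this
      refine (mul_le_mul_of_nonneg_left this (Real.exp_pos _).le).trans (le_of_eq ?_)
      rw [div_mul_cancel₀ _ hs0.ne', mul_left_comm, mul_assoc, ← Real.exp_add, ← Real.exp_add, hs]
      ring_nf
    have key' : ‖∫ y in a..x, Complex.exp (-(l * y)) * g y‖ ≤
        N * Real.exp (-l.re * a) / s * Real.exp (s * (x - a)) := by
      refine key.trans (sub_le_self _ (by positivity))
    rw [expWeight_of_nonneg hδL (by linarith)]
    refine (mul_le_mul_of_nonneg_left key' (Real.exp_pos _).le).trans ?_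
    have : Real.exp (l.re * x) * (N * Real.exp (-l.re * a) / s * Real.exp (s * (x - a)))
        = N / s * (Real.exp (l.re * x) * Real.exp (-l.re * a) * Real.exp (s * (x - a))) := by ring
    rw [this, ← Real.exp_add, ← Real.exp_add,
      show l.re * x + -l.re * a + s * (x - a) = -δ * (x - a) by rw [hs]; ring]
    gcongr
  · set s := L + l.re with hs
    have hs0 : 0 < s := by linarith
    rw [intervalIntegral.integral_symm, norm_neg]
    have key : ‖∫ y in x..a, Complex.exp (-(l * y)) * g y‖ ≤
        (-(N * Real.exp (-l.re * a) / s)) * Real.exp (-s * (a - a))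
          - (-(N * Real.exp (-l.re * a) / s)) * Real.exp (-s * (x - a)) := by
      refine norm_integral_le_sub_of_hasDerivAt hx
        (G := fun y => (-(N * Real.exp (-l.re * a) / s)) * Real.exp (-s * (y - a)))
        (hasDerivAt_exp_sub _ a (-s)) (by fun_prop) ?_
      intro y _ hy
      rw [norm_mul, norm_cexp_neg_mul_ofReal]
      have := hb y
      rw [expWeight_of_nonpos hδL (by linarith)] at this
      refine (mul_le_mul_of_nonneg_left this (Real.exp_pos _).le).trans (le_of_eq ?_)
      rw [neg_mul_neg, div_mul_cancel₀ _ hs0.ne', mul_left_comm, mul_assoc, ← Real.exp_add,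
        ← Real.exp_add, hs]
      ring_nf
    have key' : ‖∫ y in x..a, Complex.exp (-(l * y)) * g y‖ ≤
        N * Real.exp (-l.re * a) / s * Real.exp (-s * (x - a)) := by
      refine key.trans ?_
      have : 0 ≤ (N * Real.exp (-l.re * a) / s) * Real.exp (-s * (a - a)) := by positivity
      linarith
    rw [expWeight_of_nonpos hδL (by linarith)]
    refine (mul_le_mul_of_nonneg_left key' (Real.exp_pos _).le).trans ?_
    have : Real.exp (l.re * x) * (N * Real.exp (-l.re * a) / s * Real.exp (-s * (x - a)))
        = N / s * (Real.exp (l.re * x) * Real.exp (-l.re * a) * Real.exp (-s * (x - a))) := by ring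
    rw [this, ← Real.exp_add, ← Real.exp_add,
      show l.re * x + -l.re * a + -s * (x - a) = -L * (x - a) by rw [hs]; ring]
    gcongr

/-! ### A weighted fixed point theorem -/

/-- An affine equation `m = e + T m` is solvable in the space of continuous functions bounded by
a multiple of the weight `w` if `T` halves the weighted norm. -/
theorem exists_eq_add_of_weighted_contraction {E : Type*} [NormedAddCommGroup E]
    [NormedSpace ℝ E] [CompleteSpace E] {w : ℝ → ℝ} (hw : Continuous w) (hw0 : ∀ x, 0 < w x)
    (T : (ℝ → E) → ℝ → E) (e : ℝ → E) (he : Continuous e) (hew : ∀ x, ‖e x‖ ≤ w x)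
    (hTc : ∀ m M, Continuous m → 0 ≤ M → (∀ x, ‖m x‖ ≤ M * w x) → Continuous (T m))
    (hTb : ∀ m M, Continuous m → 0 ≤ M → (∀ x, ‖m x‖ ≤ M * w x) →
      ∀ x, ‖T m x‖ ≤ M / 2 * w x)
    (hTs : ∀ m m' M M', Continuous m → 0 ≤ M → (∀ x, ‖m x‖ ≤ M * w x) →
      Continuous m' → 0 ≤ M' → (∀ x, ‖m' x‖ ≤ M' * w x) → T (m - m') = T m - T m') :
    ∃ m : ℝ → E, Continuous m ∧ (∀ x, ‖m x‖ ≤ 2 * w x) ∧ ∀ x, m x = e x + T m x := by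
  have hwi : Continuous fun x => (w x)⁻¹ := hw.inv₀ fun x => (hw0 x).ne'
  have hmc : ∀ u : BoundedContinuousFunction ℝ E, Continuous fun x => w x • u x :=
    fun u => hw.smul u.continuous
  have hmb : ∀ (u : BoundedContinuousFunction ℝ E) x, ‖w x • u x‖ ≤ ‖u‖ * w x := by
    intro u x
    rw [norm_smul, Real.norm_of_nonneg (hw0 x).le, mul_comm]
    exact mul_le_mul_of_nonneg_right (u.norm_coe_le_norm x) (hw0 x).le
  have hbd : ∀ u : BoundedContinuousFunction ℝ E, ∀ x,
      ‖(w x)⁻¹ • (e x + T (fun y => w y • u y) x)‖ ≤ 1 + ‖u‖ / 2 := by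
    intro u x
    rw [norm_smul, Real.norm_of_nonneg (inv_pos.2 (hw0 x)).le, inv_mul_le_iff₀ (hw0 x)]
    refine (norm_add_le _ _).trans ?_
    have := hTb _ ‖u‖ (hmc u) (norm_nonneg u) (hmb u) x
    linarith [hew x]
  let Φ : BoundedContinuousFunction ℝ E → BoundedContinuousFunction ℝ E := fun u =>
    BoundedContinuousFunction.ofNormedAddCommGroup
      (fun x => (w x)⁻¹ • (e x + T (fun y => w y • u y) x))
      (hwi.smul (he.add (hTc _ _ (hmc u) (norm_nonneg u) (hmb u)))) (1 + ‖u‖ / 2) (hbd u)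
  have hΦ : ContractingWith (1 / 2) Φ := by
    refine ⟨by
      rw [← NNReal.coe_lt_coe]; norm_num, LipschitzWith.of_dist_le_mul fun u v => ?_⟩
    rw [BoundedContinuousFunction.dist_le (by positivity)]
    intro x
    have hs := hTs _ _ _ _ (hmc u) (norm_nonneg u) (hmb u) (hmc v) (norm_nonneg v) (hmb v)
    have heq : (fun y => w y • u y) - (fun y => w y • v y) = fun y => w y • (u - v) y := by
      funext y; simp [smul_sub]
    have hb := hTb _ ‖u - v‖ (hmc (u - v)) (norm_nonneg _) (hmb (u - v)) x
    rw [← heq, hs] at hb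
    change dist ((w x)⁻¹ • (e x + T (fun y => w y • u y) x))
      ((w x)⁻¹ • (e x + T (fun y => w y • v y) x)) ≤ _
    rw [dist_eq_norm, ← smul_sub, add_sub_add_left_eq_sub, norm_smul,
      Real.norm_of_nonneg (inv_pos.2 (hw0 x)).le, inv_mul_le_iff₀ (hw0 x), dist_eq_norm]
    refine hb.trans (le_of_eq ?_)
    push_cast; ring
  obtain ⟨u, hu⟩ : ∃ u, Φ u = u := ⟨_, hΦ.fixedPoint_isFixedPt⟩
  have hux : ∀ x, u x = (w x)⁻¹ • (e x + T (fun y => w y • u y) x) := fun x =>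
    (congrArg (fun v : BoundedContinuousFunction ℝ E => v x) hu).symm
  have hun : ‖u‖ ≤ 2 := by
    have : ‖u‖ ≤ 1 + ‖u‖ / 2 := by
      refine (BoundedContinuousFunction.norm_le (by positivity)).2 fun x => ?_
      rw [hux x]; exact hbd u x
    linarith
  refine ⟨fun x => w x • u x, hmc u, fun x => (hmb u x).trans ?_, fun x => ?_⟩
  · exact mul_le_mul_of_nonneg_right hun (hw0 x).le
  · change w x • u x = _
    conv_lhs => rw [hux x]
    rw [smul_inv_smul₀ (hw0 x).ne']

theorem expWeight_le_zero {δ L : ℝ} (hδ : 0 ≤ δ) (hL : δ ≤ L) (t : ℝ) :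
    expWeight δ L t ≤ expWeight 0 L t := by
  rcases le_total 0 t with ht | ht
  · rw [expWeight_of_nonneg hL ht, expWeight_of_nonneg (hδ.trans hL) ht]
    exact Real.exp_le_exp.2 (by nlinarith)
  · rw [expWeight_of_nonpos hL ht, expWeight_of_nonpos (hδ.trans hL) ht]

theorem expWeight_zero_le (L t : ℝ) : expWeight 0 L t ≤ 1 + Real.exp (-L * t) := by
  refine max_le ?_ ?_
  · have := Real.exp_pos (-L * t)
    simp only [neg_zero, zero_mul, Real.exp_zero]; linarith
  · linarith

theorem one_le_expWeight_zero (L t : ℝ) : 1 ≤ expWeight 0 L t :=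
  le_max_of_le_left (by simp)

theorem ExpBdd.norm_le_expWeight {a δ τ L A : ℝ} {g : ℝ → ℂ} (h : ExpBdd a τ L g A A)
    (hA : 0 ≤ A) (h1 : δ ≤ τ) (h2 : τ ≤ L) (x : ℝ) :
    ‖g x‖ ≤ 2 * A * expWeight δ L (x - a) := by
  have e1 := mul_le_mul_of_nonneg_left (exp_le_expWeight h1 h2 (x - a)) hA
  have e2 := mul_le_mul_of_nonneg_left (exp_le_expWeight (h1.trans h2) le_rfl (x - a)) hA
  linarith [h x]

theorem ExpBdd.mono {a τ L A B A' B' : ℝ} {g : ℝ → ℂ} (h : ExpBdd a τ L g A B)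
    (hA : A ≤ A') (hB : B ≤ B') : ExpBdd a τ L g A' B' := by
  intro x
  refine (h x).trans ?_
  gcongr

/-! ### The integral operator of the linearized system -/

/-- One row of the potential term of the linearized system. -/
noncomputable def potTerm (V W : ℝ → ℝ) (m : ℝ → ℂ × ℂ) (y : ℝ) : ℂ :=
  -((V y : ℂ) * (m y).1 + (W y : ℂ) * (m y).2)

/-- The integral operator whose affine fixed points solve
`m₁'' + 2 i k m₁' = -(V m₁ + W m₂)` and `m₂'' + 2 i k m₂' - (k² + μ²) m₂ = -(W m₁ + V m₂)`. -/
noncomputable def jostOp (a : ℝ) (k μ : ℂ) (V W : ℝ → ℝ) (m : ℝ → ℂ × ℂ) (x : ℝ) : ℂ × ℂ :=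
  (bwdSol 0 (bwdSol (-(2 * Complex.I * k)) (potTerm V W m)) x,
    fwdSol a (-μ - Complex.I * k) (bwdSol (μ - Complex.I * k) (potTerm W V m)) x)

theorem continuous_potTerm {V W : ℝ → ℝ} (hV : Continuous V) (hW : Continuous W)
    {m : ℝ → ℂ × ℂ} (hm : Continuous m) : Continuous (potTerm V W m) := by
  unfold potTerm; fun_prop

theorem potTerm_sub (V W : ℝ → ℝ) (m m' : ℝ → ℂ × ℂ) :
    potTerm V W (m - m') = potTerm V W m - potTerm V W m' := by
  funext y; simp only [potTerm, Pi.sub_apply, Prod.fst_sub, Prod.snd_sub]; ring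

theorem norm_potTerm_le (V W : ℝ → ℝ) (m : ℝ → ℂ × ℂ) (y : ℝ) :
    ‖potTerm V W m y‖ ≤ (|V y| + |W y|) * ‖m y‖ := by
  rw [potTerm, norm_neg, add_mul]
  refine (norm_add_le _ _).trans (add_le_add ?_ ?_) <;> rw [norm_mul, Complex.norm_real]
  · exact mul_le_mul_of_nonneg_left (norm_fst_le _) (norm_nonneg _)
  · exact mul_le_mul_of_nonneg_left (norm_snd_le _) (norm_nonneg _)

/-- Decay of a pair of potentials at `+∞`, together with global boundedness. -/
structure PotDecay (ρ C : ℝ) (V W : ℝ → ℝ) : Prop where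
  cont_left : Continuous V
  cont_right : Continuous W
  le_const : ∀ y, |V y| + |W y| ≤ C
  le_exp : ∀ y, |V y| + |W y| ≤ C * Real.exp (-ρ * y)

theorem PotDecay.symm {ρ C : ℝ} {V W : ℝ → ℝ} (h : PotDecay ρ C V W) : PotDecay ρ C W V :=
  ⟨h.cont_right, h.cont_left, fun y => by rw [add_comm]; exact h.le_const y,
    fun y => by rw [add_comm]; exact h.le_exp y⟩

theorem PotDecay.expBdd_potTerm {ρ C a L M : ℝ} {V W : ℝ → ℝ} (h : PotDecay ρ C V W)
    (hM : 0 ≤ M) {m : ℝ → ℂ × ℂ} (hm : ∀ x, ‖m x‖ ≤ M * expWeight 0 L (x - a)) :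
    ExpBdd a ρ L (potTerm V W m) (M * C * Real.exp (-ρ * a)) (M * C) := by
  intro y
  have hs : 0 ≤ |V y| + |W y| := by positivity
  have h1 : ‖potTerm V W m y‖ ≤ (|V y| + |W y|) * (M * (1 + Real.exp (-L * (y - a)))) := by
    refine (norm_potTerm_le V W m y).trans (mul_le_mul_of_nonneg_left ?_ hs)
    exact (hm y).trans (mul_le_mul_of_nonneg_left (expWeight_zero_le L _) hM)
  have h2 := mul_le_mul_of_nonneg_left (h.le_exp y) hM
  have h3 := mul_le_mul_of_nonneg_right (mul_le_mul_of_nonneg_left (h.le_const y) hM)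
    (Real.exp_pos (-L * (y - a))).le
  have h4 : Real.exp (-ρ * y) = Real.exp (-ρ * a) * Real.exp (-ρ * (y - a)) := by
    rw [← Real.exp_add]; ring_nf
  rw [h4] at h2
  linarith

/-- The parameters of the integral operator: the potentials decay at rate `ρ > γ`, the weight
exponent `L` is large, and the exponents `±μ - ik` are separated by a gap. -/
structure JostParams (a γ ρ δ C K L : ℝ) (k μ : ℂ) (V W : ℝ → ℝ) : Prop where
  pot : PotDecay ρ C V W
  C_pos : 0 < C
  γ_pos : 0 < γ
  γ_lt : γ < ρ
  δ_pos : 0 < δ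
  δ_le : δ ≤ ρ
  ρ_le : ρ ≤ L
  γ_add_one_le : γ + 1 ≤ L
  one_le : 1 ≤ Real.exp (-ρ * a) * (L - γ)
  im_ge : -(γ / 2) ≤ k.im
  re_nonneg : 0 ≤ μ.re
  gap : 2 * δ ≤ μ.re - k.im
  gap_le : 2 * (μ.re - k.im) ≤ L
  K_pos : 0 < K
  le_gap : 1 + ‖k‖ ≤ K * (μ.re - k.im)
  sq_eq : μ ^ 2 = k ^ 2 + 2
  norm_le : ‖μ‖ ≤ ‖k‖ + 2

namespace JostParams

variable {a γ ρ δ C K L M : ℝ} {k μ : ℂ} {V W : ℝ → ℝ} {m : ℝ → ℂ × ℂ} {l : ℂ}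

theorem expBdd_bwdSol_potTerm (P : JostParams a γ ρ δ C K L k μ V W) {V' W' : ℝ → ℝ}
    (hV : PotDecay ρ C V' W') (hM : 0 ≤ M)
    (hm : ∀ x, ‖m x‖ ≤ M * expWeight 0 L (x - a)) (hl : -γ ≤ l.re) :
    ExpBdd a ρ L (bwdSol l (potTerm V' W' m))
      (M * (C * (1 + 1 / (ρ - γ)) * Real.exp (-ρ * a)))
      (M * (C * (1 + 1 / (ρ - γ)) * Real.exp (-ρ * a))) := by
  have hC := P.C_pos
  have h1 := P.γ_lt
  have h2 := P.γ_add_one_le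
  have hργ : 0 < ρ - γ := by linarith
  have hLγ : 0 < L - γ := by linarith
  have hE := Real.exp_pos (-ρ * a)
  refine ((hV.expBdd_potTerm hM hm).expBdd_bwdSol (by positivity) (by positivity) hl h1
    (by linarith)).mono ?_ ?_
  · have : 0 ≤ M * C * Real.exp (-ρ * a) := by positivity
    calc _ = M * C * Real.exp (-ρ * a) * (1 / (ρ - γ)) := by ring
      _ ≤ M * C * Real.exp (-ρ * a) * (1 + 1 / (ρ - γ)) := by gcongr; linarith
      _ = _ := by ring
  · rw [div_le_iff₀ hLγ]
    have : 0 ≤ M * C := by positivity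
    calc M * C = M * C * 1 * 1 := by ring
      _ ≤ M * C * (1 + 1 / (ρ - γ)) * (Real.exp (-ρ * a) * (L - γ)) := by
        gcongr
        · linarith [one_div_pos.2 hργ]
        · exact P.one_le
      _ = _ := by ring

theorem norm_bwdSol_potTerm_le (P : JostParams a γ ρ δ C K L k μ V W) {V' W' : ℝ → ℝ}
    (hV : PotDecay ρ C V' W') (hM : 0 ≤ M)
    (hm : ∀ x, ‖m x‖ ≤ M * expWeight 0 L (x - a)) (hl : -γ ≤ l.re) (x : ℝ) :
    ‖bwdSol l (potTerm V' W' m) x‖ ≤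
      2 * (M * (C * (1 + 1 / (ρ - γ)) * Real.exp (-ρ * a))) * expWeight δ L (x - a) := by
  have hC := P.C_pos
  have hργ : 0 < ρ - γ := by linarith [P.γ_lt]
  exact (P.expBdd_bwdSol_potTerm hV hM hm hl).norm_le_expWeight (by positivity) P.δ_le P.ρ_le x

theorem re_fst (P : JostParams a γ ρ δ C K L k μ V W) : -γ ≤ (-(2 * Complex.I * k)).re := by
  have := P.im_ge
  simp; linarith

theorem re_snd (P : JostParams a γ ρ δ C K L k μ V W) : -γ ≤ (μ - Complex.I * k).re := by
  have := P.im_ge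
  have := P.re_nonneg
  have := P.γ_pos
  simp; linarith

theorem hasDerivAt_bwdSol_potTerm (P : JostParams a γ ρ δ C K L k μ V W) {V' W' : ℝ → ℝ}
    (hV : PotDecay ρ C V' W') (hM : 0 ≤ M) (hmc : Continuous m)
    (hm : ∀ x, ‖m x‖ ≤ M * expWeight 0 L (x - a)) (hl : -γ ≤ l.re) (x : ℝ) :
    HasDerivAt (bwdSol l (potTerm V' W' m))
      (l * bwdSol l (potTerm V' W' m) x + potTerm V' W' m x) x := by
  have h1 := P.γ_lt
  have h2 := P.γ_add_one_le
  exact (hV.expBdd_potTerm hM hm).hasDerivAt_bwdSol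
    (continuous_potTerm hV.cont_left hV.cont_right hmc) (by linarith) (by linarith) x

theorem continuous_bwdSol_potTerm (P : JostParams a γ ρ δ C K L k μ V W) {V' W' : ℝ → ℝ}
    (hV : PotDecay ρ C V' W') (hM : 0 ≤ M) (hmc : Continuous m)
    (hm : ∀ x, ‖m x‖ ≤ M * expWeight 0 L (x - a)) (hl : -γ ≤ l.re) :
    Continuous (bwdSol l (potTerm V' W' m)) :=
  continuous_iff_continuousAt.2 fun x =>
    (P.hasDerivAt_bwdSol_potTerm hV hM hmc hm hl x).continuousAt

theorem hasDerivAt_jostOp_fst (P : JostParams a γ ρ δ C K L k μ V W) (hM : 0 ≤ M)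
    (hmc : Continuous m) (hm : ∀ x, ‖m x‖ ≤ M * expWeight 0 L (x - a)) (x : ℝ) :
    HasDerivAt (fun x => (jostOp a k μ V W m x).1)
      (bwdSol (-(2 * Complex.I * k)) (potTerm V W m) x) x := by
  have h0 := P.γ_pos
  have h1 := P.γ_lt
  have h2 := P.γ_add_one_le
  have := (P.expBdd_bwdSol_potTerm P.pot hM hm P.re_fst).hasDerivAt_bwdSol (l := 0)
    (P.continuous_bwdSol_potTerm P.pot hM hmc hm P.re_fst) (by simp; linarith) (by simp; linarith) x
  simpa [jostOp] using this

theorem hasDerivAt_jostOp_snd (P : JostParams a γ ρ δ C K L k μ V W) (hM : 0 ≤ M)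
    (hmc : Continuous m) (hm : ∀ x, ‖m x‖ ≤ M * expWeight 0 L (x - a)) (x : ℝ) :
    HasDerivAt (fun x => (jostOp a k μ V W m x).2)
      ((-μ - Complex.I * k) * (jostOp a k μ V W m x).2
        + bwdSol (μ - Complex.I * k) (potTerm W V m) x) x :=
  hasDerivAt_fwdSol a _ (P.continuous_bwdSol_potTerm P.pot.symm hM hmc hm P.re_snd) x

theorem continuous_jostOp (P : JostParams a γ ρ δ C K L k μ V W) (hM : 0 ≤ M)
    (hmc : Continuous m) (hm : ∀ x, ‖m x‖ ≤ M * expWeight 0 L (x - a)) :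
    Continuous (jostOp a k μ V W m) :=
  (continuous_iff_continuousAt.2 fun x =>
    (P.hasDerivAt_jostOp_fst hM hmc hm x).continuousAt).prodMk
  (continuous_iff_continuousAt.2 fun x =>
    (P.hasDerivAt_jostOp_snd hM hmc hm x).continuousAt)

theorem jostOp_sub (P : JostParams a γ ρ δ C K L k μ V W) {M' : ℝ} {m' : ℝ → ℂ × ℂ}
    (hM : 0 ≤ M) (hmc : Continuous m) (hm : ∀ x, ‖m x‖ ≤ M * expWeight 0 L (x - a))
    (hM' : 0 ≤ M') (hmc' : Continuous m') (hm' : ∀ x, ‖m' x‖ ≤ M' * expWeight 0 L (x - a)) :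
    jostOp a k μ V W (m - m') = jostOp a k μ V W m - jostOp a k μ V W m' := by
  have h0 := P.γ_pos
  have h1 := P.γ_lt
  have h2 := P.γ_add_one_le
  have h3 := P.re_fst
  have h4 := P.re_snd
  have e1 := (P.pot.expBdd_potTerm hM hm).bwdSol_sub (l := -(2 * Complex.I * k))
    (continuous_potTerm P.pot.cont_left P.pot.cont_right hmc)
    (P.pot.expBdd_potTerm hM' hm') (continuous_potTerm P.pot.cont_left P.pot.cont_right hmc')
    (by linarith) (by linarith)
  have e2 := (P.pot.symm.expBdd_potTerm hM hm).bwdSol_sub (l := μ - Complex.I * k)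
    (continuous_potTerm P.pot.cont_right P.pot.cont_left hmc)
    (P.pot.symm.expBdd_potTerm hM' hm') (continuous_potTerm P.pot.cont_right P.pot.cont_left hmc')
    (by linarith) (by linarith)
  have e3 := (P.expBdd_bwdSol_potTerm P.pot hM hm P.re_fst).bwdSol_sub (l := 0)
    (P.continuous_bwdSol_potTerm P.pot hM hmc hm P.re_fst)
    (P.expBdd_bwdSol_potTerm P.pot hM' hm' P.re_fst)
    (P.continuous_bwdSol_potTerm P.pot hM' hmc' hm' P.re_fst)
    (by simp; linarith) (by simp; linarith)
  have e4 := fwdSol_sub a (-μ - Complex.I * k)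
    (P.continuous_bwdSol_potTerm P.pot.symm hM hmc hm P.re_snd)
    (P.continuous_bwdSol_potTerm P.pot.symm hM' hmc' hm' P.re_snd)
  funext x
  simp only [jostOp, potTerm_sub, e1, e2, e3, e4, Pi.sub_apply, Prod.mk_sub_mk]

theorem norm_jostOp_fst_le (P : JostParams a γ ρ δ C K L k μ V W) (hM : 0 ≤ M)
    (hmc : Continuous m) (hm : ∀ x, ‖m x‖ ≤ M * expWeight 0 L (x - a)) (x : ℝ) :
    (1 + ‖k‖) * ‖(jostOp a k μ V W m x).1‖ ≤ 2 * (3 + 1 / (ρ - γ)) *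
      (M * (C * (1 + 1 / (ρ - γ)) * Real.exp (-ρ * a))) * expWeight δ L (x - a) := by
  have hC := P.C_pos
  have hργ : 0 < ρ - γ := by linarith [P.γ_lt]
  have h0 := P.γ_pos
  have h1 := P.γ_lt
  have h2 := P.γ_add_one_le
  set N := M * (C * (1 + 1 / (ρ - γ)) * Real.exp (-ρ * a)) with hN
  have hN0 : 0 ≤ N := by positivity
  set F := potTerm V W m with hF
  have hpf := (P.pot.expBdd_potTerm hM hm).mul_bwdSol_zero_bwdSol
    (continuous_potTerm P.pot.cont_left P.pot.cont_right hmc) (by positivity) (by positivity)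
    h0.le P.re_fst h1 (by linarith) x
  have b1 := P.norm_bwdSol_potTerm_le P.pot hM hm P.re_fst x
  have b2 := P.norm_bwdSol_potTerm_le P.pot hM hm (l := 0) (by simp; linarith) x
  have hv := P.expBdd_bwdSol_potTerm P.pot hM hm P.re_fst
  rw [← hF, ← hN] at hv b1 b2
  rw [← hF] at hpf
  have hu := ((hv.expBdd_bwdSol hN0 hN0 (l := 0) (α := γ) (by simp; linarith) h1
    (by linarith)).mono (A' := N * (1 + 1 / (ρ - γ))) (B' := N * (1 + 1 / (ρ - γ)))
    (by rw [div_eq_mul_one_div]; gcongr; linarith)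
    (by
      refine (div_le_self hN0 (by linarith)).trans (le_mul_of_one_le_right hN0 ?_)
      linarith [one_div_pos.2 hργ])).norm_le_expWeight (by positivity) P.δ_le P.ρ_le x
  have hn : 2 * ‖k‖ * ‖(jostOp a k μ V W m x).1‖ ≤
      ‖bwdSol (-(2 * Complex.I * k)) F x‖ + ‖bwdSol 0 F x‖ := by
    have := congrArg norm hpf
    rw [norm_mul] at this
    have e : ‖-(2 * Complex.I * k)‖ = 2 * ‖k‖ := by simp
    rw [e] at this
    simp only [jostOp, ← hF]
    rw [this]
    exact norm_sub_le _ _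
  have hu' : ‖(jostOp a k μ V W m x).1‖ ≤ 2 * (N * (1 + 1 / (ρ - γ))) * expWeight δ L (x - a) :=
    hu
  have hk : 0 ≤ ‖k‖ * ‖(jostOp a k μ V W m x).1‖ := by positivity
  linarith

theorem norm_jostOp_snd_le (P : JostParams a γ ρ δ C K L k μ V W) (hM : 0 ≤ M)
    (hm : ∀ x, ‖m x‖ ≤ M * expWeight 0 L (x - a)) (x : ℝ) :
    (1 + ‖k‖) * ‖(jostOp a k μ V W m x).2‖ ≤ 4 * K *
      (M * (C * (1 + 1 / (ρ - γ)) * Real.exp (-ρ * a))) * expWeight δ L (x - a) := by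
  have hC := P.C_pos
  have hK := P.K_pos
  have hργ : 0 < ρ - γ := by linarith [P.γ_lt]
  have h1 := P.gap
  have h2 := P.gap_le
  have h3 := P.δ_pos
  have hk : 0 < 1 + ‖k‖ := by positivity
  have hc : (1 + ‖k‖) / (2 * K) ≤ (μ.re - k.im) / 2 := by
    rw [div_le_iff₀ (by positivity)]
    linarith [P.le_gap]
  have hre : (-μ - Complex.I * k).re = -(μ.re - k.im) := by simp; ring
  have := norm_fwdSol_le (a := a) (δ := δ) (L := L) (l := -μ - Complex.I * k)
    (c := (1 + ‖k‖) / (2 * K)) (by positivity) (by positivity) (P.δ_le.trans P.ρ_le)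
    (by rw [hre]; linarith) (by rw [hre]; linarith)
    (P.norm_bwdSol_potTerm_le P.pot.symm hM hm P.re_snd) x
  refine (mul_le_mul_of_nonneg_left this hk.le).trans (le_of_eq ?_)
  field_simp
  ring

theorem norm_jostOp_le (P : JostParams a γ ρ δ C K L k μ V W) (hM : 0 ≤ M)
    (hmc : Continuous m) (hm : ∀ x, ‖m x‖ ≤ M * expWeight 0 L (x - a)) (x : ℝ) :
    ‖jostOp a k μ V W m x‖ ≤ M * ((6 + 2 / (ρ - γ) + 4 * K) * (C * (1 + 1 / (ρ - γ))) *
      Real.exp (-ρ * a)) * (1 + ‖k‖)⁻¹ * expWeight δ L (x - a) := by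
  have hC := P.C_pos
  have hK := P.K_pos
  have hργ : 0 < ρ - γ := by linarith [P.γ_lt]
  have hk : 0 < 1 + ‖k‖ := by positivity
  have h1 := P.norm_jostOp_fst_le hM hmc hm x
  have h2 := P.norm_jostOp_snd_le hM hm x
  set N := M * (C * (1 + 1 / (ρ - γ)) * Real.exp (-ρ * a)) * expWeight δ L (x - a) with hN
  have hN0 : 0 ≤ N := by
    have := expWeight_pos δ L (x - a)
    positivity
  have e : M * ((6 + 2 / (ρ - γ) + 4 * K) * (C * (1 + 1 / (ρ - γ))) *
      Real.exp (-ρ * a)) * (1 + ‖k‖)⁻¹ * expWeight δ L (x - a)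
      = (1 + ‖k‖)⁻¹ * ((6 + 2 / (ρ - γ) + 4 * K) * N) := by rw [hN]; ring
  rw [e, Prod.norm_def]
  have h3 : 0 ≤ 1 / (ρ - γ) * N := by positivity
  have h4 : 0 ≤ K * N := by positivity
  have h5 : 2 / (ρ - γ) = 2 * (1 / (ρ - γ)) := by ring
  refine max_le ?_ ?_ <;> rw [le_inv_mul_iff₀ hk, h5]
  · refine h1.trans ?_
    have : 2 * (3 + 1 / (ρ - γ)) * (M * (C * (1 + 1 / (ρ - γ)) * Real.exp (-ρ * a))) *
      expWeight δ L (x - a) = 2 * (3 + 1 / (ρ - γ)) * N := by rw [hN]; ring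
    rw [this]; linarith
  · refine h2.trans ?_
    have : 4 * K * (M * (C * (1 + 1 / (ρ - γ)) * Real.exp (-ρ * a))) *
      expWeight δ L (x - a) = 4 * K * N := by rw [hN]; ring
    rw [this]; linarith

/-- Solvability of the integral equation `m = (1, 0) + T m` in the contractive regime. -/
theorem exists_fixedPoint (P : JostParams a γ ρ δ C K L k μ V W)
    (hsmall : 2 * ((6 + 2 / (ρ - γ) + 4 * K) * (C * (1 + 1 / (ρ - γ)))) * Real.exp (-ρ * a)
      ≤ 1 + ‖k‖) :
    ∃ m : ℝ → ℂ × ℂ, Continuous m ∧ (∀ x, ‖m x‖ ≤ 2 * expWeight 0 L (x - a)) ∧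
      ∀ x, m x = (1, 0) + jostOp a k μ V W m x := by
  have hk : 0 < 1 + ‖k‖ := by positivity
  have hL : δ ≤ L := P.δ_le.trans P.ρ_le
  refine exists_eq_add_of_weighted_contraction (continuous_expWeight 0 L a)
    (fun x => expWeight_pos 0 L _) (jostOp a k μ V W) (fun _ => (1, 0)) continuous_const
    (fun x => ?_) (fun m M hmc hM hm => P.continuous_jostOp hM hmc hm)
    (fun m M hmc hM hm x => ?_)
    (fun m m' M M' hmc hM hm hmc' hM' hm' => P.jostOp_sub hM hmc hm hM' hmc' hm')
  · simpa [Prod.norm_def] using one_le_expWeight_zero L (x - a)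
  · refine (P.norm_jostOp_le hM hmc hm x).trans ?_
    have h1 := expWeight_le_zero P.δ_pos.le hL (x - a)
    refine mul_le_mul ?_ h1 (expWeight_pos _ _ _).le (by positivity)
    rw [mul_inv_le_iff₀ hk]
    have := mul_le_mul_of_nonneg_left hsmall (half_pos one_pos).le
    have := mul_le_mul_of_nonneg_left this hM
    linarith

end JostParams

/-! ### The ground state potential and the exponents at infinity -/

theorem groundState_rpow {p : ℝ} (hp : 1 < p) (x : ℝ) :
    groundState p x ^ (p - 1) = (p + 1) / 2 / Real.cosh ((p - 1) * x / 2) ^ 2 := by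
  have h1 : p - 1 ≠ 0 := by linarith
  have hc := Real.cosh_pos ((p - 1) * x / 2)
  have hp2 : 0 ≤ (p + 1) / 2 := by linarith
  rw [groundState, Real.mul_rpow (Real.rpow_nonneg hp2 _) (Real.rpow_nonneg (by positivity) _),
    ← Real.rpow_mul hp2, ← Real.rpow_mul (by positivity), div_mul_cancel₀ _ h1,
    div_mul_cancel₀ _ h1, Real.rpow_one, Real.rpow_two]
  field_simp

theorem exp_le_four_mul_cosh_sq (x : ℝ) : Real.exp (2 * x) ≤ 4 * Real.cosh x ^ 2 := by
  have h : Real.exp (2 * x) = Real.exp x * Real.exp x := by rw [← Real.exp_add]; ring_nf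
  rw [h, Real.cosh_eq]
  nlinarith [Real.exp_pos x, Real.exp_pos (-x)]

theorem potDecay_groundState {p : ℝ} (hp : 1 < p) :
    PotDecay (p - 1) (2 * p * (p + 1)) (fun x => (p + 1) / 2 * groundState p x ^ (p - 1))
      (fun x => (p - 1) / 2 * groundState p x ^ (p - 1)) := by
  have hcont : Continuous fun x => groundState p x ^ (p - 1) := by
    simp only [groundState_rpow hp]
    refine continuous_const.div (by fun_prop) fun x => ?_
    exact pow_ne_zero _ (Real.cosh_pos _).ne'
  have hsum : ∀ y, |(p + 1) / 2 * groundState p y ^ (p - 1)|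
      + |(p - 1) / 2 * groundState p y ^ (p - 1)|
      = p * ((p + 1) / 2 / Real.cosh ((p - 1) * y / 2) ^ 2) := by
    intro y
    have hc := Real.cosh_pos ((p - 1) * y / 2)
    have : 0 ≤ (p + 1) / 2 / Real.cosh ((p - 1) * y / 2) ^ 2 :=
      div_nonneg (by linarith) (by positivity)
    rw [groundState_rpow hp, abs_of_nonneg (mul_nonneg (by linarith) this),
      abs_of_nonneg (mul_nonneg (by linarith) this)]
    ring
  refine ⟨continuous_const.mul hcont, continuous_const.mul hcont, fun y => ?_, fun y => ?_⟩ <;>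
    rw [hsum] <;> have hc := Real.cosh_pos ((p - 1) * y / 2) <;>
    have hpp : 0 < p * (p + 1) := by nlinarith
  · have h1 := Real.one_le_cosh ((p - 1) * y / 2)
    have h2 : 1 ≤ Real.cosh ((p - 1) * y / 2) ^ 2 := one_le_pow₀ h1
    rw [div_div, ← mul_div_assoc, div_le_iff₀ (by positivity)]
    nlinarith
  · have h1 := exp_le_four_mul_cosh_sq ((p - 1) * y / 2)
    have h2 : Real.exp (-(p - 1) * y) * Real.exp (2 * ((p - 1) * y / 2)) = 1 := by
      rw [← Real.exp_add, ← Real.exp_zero]; ring_nf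
    have h3 := mul_le_mul_of_nonneg_left h1 (Real.exp_pos (-(p - 1) * y)).le
    rw [h2] at h3
    rw [div_div, ← mul_div_assoc, div_le_iff₀ (by positivity)]
    nlinarith

/-- The square root of `k² + 2` in the right half plane is separated from `-ik`, uniformly and
with linear growth, for `k` in a horizontal strip strictly below `Im k = 1`. -/
theorem exists_sqrt_gap {B ε : ℝ} (hB : 1 ≤ B) (hε : 0 < ε) (hε1 : ε < 1) {k : ℂ}
    (h1 : -B ≤ k.im) (h2 : k.im ≤ 1 - ε) :
    ∃ μ : ℂ, μ ^ 2 = k ^ 2 + 2 ∧ 0 ≤ μ.re ∧ ε ≤ μ.re - k.im ∧ ‖μ‖ ≤ ‖k‖ + 2 ∧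
      1 + ‖k‖ ≤ (1 + (3 * B + 1) / ε) * (μ.re - k.im) := by
  obtain ⟨μ, hμ, hre⟩ : ∃ μ : ℂ, μ ^ 2 = k ^ 2 + 2 ∧ 0 ≤ μ.re := by
    obtain ⟨z, hz⟩ := IsAlgClosed.exists_pow_nat_eq (k ^ 2 + 2) two_pos
    rcases le_total 0 z.re with h | h
    · exact ⟨z, hz, h⟩
    · exact ⟨-z, by rw [neg_sq, hz], by simpa using h⟩
  have hr : μ.re ^ 2 - μ.im ^ 2 = k.re ^ 2 - k.im ^ 2 + 2 := by
    have := congrArg Complex.re hμ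
    simp [sq] at this
    linarith
  have hlow : k.re ^ 2 - k.im ^ 2 + 2 ≤ μ.re ^ 2 := by nlinarith [sq_nonneg μ.im]
  have hgap : ε ≤ μ.re - k.im := by
    rcases le_total k.im (-1) with h | h
    · linarith
    · have : 1 ≤ μ.re := by nlinarith [sq_nonneg k.re]
      linarith
  have hlin : |k.re| ≤ μ.re + |k.im| := by
    by_contra! h
    nlinarith [sq_abs k.re, sq_abs k.im, abs_nonneg k.im, abs_nonneg k.re]
  have him : |k.im| ≤ B := abs_le.2 ⟨h1, by linarith⟩
  have hk := Complex.norm_le_abs_re_add_abs_im k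
  refine ⟨μ, hμ, hre, hgap, ?_, ?_⟩
  · have h3 : ‖μ‖ ^ 2 ≤ ‖k‖ ^ 2 + 2 := by
      rw [← norm_pow, hμ]
      exact (norm_add_le (k ^ 2) 2).trans (by rw [norm_pow]; norm_num)
    nlinarith [norm_nonneg k, norm_nonneg μ]
  · have h3 : 3 * B + 1 ≤ (3 * B + 1) / ε * (μ.re - k.im) := by
      rw [div_mul_eq_mul_div, le_div_iff₀ hε]
      gcongr
    linarith [le_abs_self k.im]

/-! ### The Jost solution -/

theorem contDiff_two_of_hasDerivAt {f f' f'' : ℝ → ℂ} (h : ∀ x, HasDerivAt f (f' x) x)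
    (h' : ∀ x, HasDerivAt f' (f'' x) x) (hc : Continuous f'') : ContDiff ℝ 2 f := by
  have e : deriv f = f' := funext fun x => (h x).deriv
  have e' : deriv f' = f'' := funext fun x => (h' x).deriv
  have : ContDiff ℝ 1 f' :=
    contDiff_one_iff_deriv.2 ⟨fun x => (h' x).differentiableAt, e' ▸ hc⟩
  exact (contDiff_succ_iff_deriv (n := 1)).2
    ⟨fun x => (h x).differentiableAt, by simp, e ▸ this⟩

/-- For a fixed spectral parameter: the solution of the linearized system, with bounds for
`e^{-ikx} f` and its derivative in terms of the exponential weight. -/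
theorem JostParams.exists_solution {a γ ρ δ C K L : ℝ} {k μ : ℂ} {V W : ℝ → ℝ}
    (P : JostParams a γ ρ δ C K L k μ V W) {D : ℝ}
    (hD : D = (6 + 2 / (ρ - γ) + 4 * K) * (C * (1 + 1 / (ρ - γ))))
    (hsmall : 2 * D * Real.exp (-ρ * a) ≤ 1 + ‖k‖) :
    ∃ f : ℝ → ℂ × ℂ,
      (ContDiff ℝ 2 (fun x => (f x).1) ∧ ContDiff ℝ 2 (fun x => (f x).2)) ∧
      (∀ x, deriv (deriv fun y => (f y).1) x
          = -k ^ 2 * (f x).1 - (V x * (f x).1 + W x * (f x).2) ∧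
        deriv (deriv fun y => (f y).2) x
          = (k ^ 2 + 2) * (f x).2 - (W x * (f x).1 + V x * (f x).2)) ∧
      ∀ x : ℝ, ‖(Complex.exp (-(Complex.I * k * (x : ℂ))) * (f x).1 - 1,
            Complex.exp (-(Complex.I * k * (x : ℂ))) * (f x).2)‖
          ≤ 2 * (D * Real.exp (-ρ * a)) * (1 + ‖k‖)⁻¹ * expWeight δ L (x - a) ∧
        ‖(deriv (fun y : ℝ => Complex.exp (-(Complex.I * k * (y : ℂ))) * (f y).1) x,
          deriv (fun y : ℝ => Complex.exp (-(Complex.I * k * (y : ℂ))) * (f y).2) x)‖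
          ≤ 6 * (D * Real.exp (-ρ * a)) * expWeight δ L (x - a) := by
  obtain ⟨m, hmc, hm, hfix⟩ := P.exists_fixedPoint (hD ▸ hsmall)
  have hk : 0 < 1 + ‖k‖ := by positivity
  have hργ : 0 < ρ - γ := by linarith [P.γ_lt]
  have hC := P.C_pos
  have hK := P.K_pos
  set v₁ := bwdSol (-(2 * Complex.I * k)) (potTerm V W m) with hv₁
  set v₂ := bwdSol (μ - Complex.I * k) (potTerm W V m) with hv₂
  have hm1 : (fun x => (m x).1) = fun x => 1 + (jostOp a k μ V W m x).1 := by
    funext x; conv_lhs => rw [hfix x]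
    rfl
  have hm2 : (fun x => (m x).2) = fun x => (jostOp a k μ V W m x).2 := by
    funext x; conv_lhs => rw [hfix x]
    simp
  have d1 : ∀ x, HasDerivAt (fun x => (m x).1) (v₁ x) x := fun x => by
    rw [hm1]
    exact (P.hasDerivAt_jostOp_fst zero_le_two hmc hm x).const_add 1
  have d2 : ∀ x, HasDerivAt (fun x => (m x).2) ((-μ - Complex.I * k) * (m x).2 + v₂ x) x :=
    fun x => by
      have := P.hasDerivAt_jostOp_snd zero_le_two hmc hm x
      rw [← hm2, ← congrFun hm2 x] at this
      exact this
  have d3 := P.hasDerivAt_bwdSol_potTerm P.pot zero_le_two hmc hm P.re_fst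
  have d4 := P.hasDerivAt_bwdSol_potTerm P.pot.symm zero_le_two hmc hm P.re_snd
  rw [← hv₁] at d3
  rw [← hv₂] at d4
  have hv₁c : Continuous v₁ := P.continuous_bwdSol_potTerm P.pot zero_le_two hmc hm P.re_fst
  have hv₂c : Continuous v₂ := P.continuous_bwdSol_potTerm P.pot.symm zero_le_two hmc hm P.re_snd
  have hVc := P.pot.cont_left
  have hWc := P.pot.cont_right
  have dE := fun x => hasDerivAt_cexp_mul (Complex.I * k) x
  have hEc : Continuous fun x : ℝ => Complex.exp (Complex.I * k * x) := by fun_prop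
  have f1 : ∀ x : ℝ, HasDerivAt (fun x : ℝ => Complex.exp (Complex.I * k * x) * (m x).1)
      (Complex.exp (Complex.I * k * x) * (Complex.I * k * (m x).1 + v₁ x)) x := fun x =>
    ((dE x).mul (d1 x)).congr_deriv (by ring)
  have f1' : ∀ x : ℝ, HasDerivAt
      (fun x : ℝ => Complex.exp (Complex.I * k * x) * (Complex.I * k * (m x).1 + v₁ x))
      (Complex.exp (Complex.I * k * x)
        * (-k ^ 2 * (m x).1 - (V x * (m x).1 + W x * (m x).2))) x := fun x =>
    ((dE x).mul (((d1 x).const_mul (Complex.I * k)).add (d3 x))).congr_deriv (by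
      simp only [potTerm, Pi.add_apply]
      linear_combination (Complex.exp (Complex.I * k * x) * k ^ 2 * (m x).1) * Complex.I_sq)
  have f2 : ∀ x : ℝ, HasDerivAt (fun x : ℝ => Complex.exp (Complex.I * k * x) * (m x).2)
      (Complex.exp (Complex.I * k * x) * (-μ * (m x).2 + v₂ x)) x := fun x =>
    ((dE x).mul (d2 x)).congr_deriv (by ring)
  have f2' : ∀ x : ℝ, HasDerivAt
      (fun x : ℝ => Complex.exp (Complex.I * k * x) * (-μ * (m x).2 + v₂ x))
      (Complex.exp (Complex.I * k * x)
        * ((k ^ 2 + 2) * (m x).2 - (W x * (m x).1 + V x * (m x).2))) x := fun x =>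
    ((dE x).mul (((d2 x).const_mul (-μ)).add (d4 x))).congr_deriv (by
      simp only [potTerm, Pi.add_apply]
      linear_combination (Complex.exp (Complex.I * k * x) * (m x).2) * P.sq_eq)
  have hinv : ∀ (x : ℝ) (z : ℂ), Complex.exp (-(Complex.I * k * (x : ℂ))) *
      (Complex.exp (Complex.I * k * x) * z) = z := fun x z => by
    rw [← mul_assoc, ← Complex.exp_add]; simp
  have hT := P.norm_jostOp_le zero_le_two hmc hm
  rw [← hD] at hT
  refine ⟨fun x => (Complex.exp (Complex.I * k * x) * (m x).1,
    Complex.exp (Complex.I * k * x) * (m x).2), ⟨?_, ?_⟩, fun x => ⟨?_, ?_⟩, fun x => ⟨?_, ?_⟩⟩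
  · exact contDiff_two_of_hasDerivAt f1 f1' (by fun_prop)
  · exact contDiff_two_of_hasDerivAt f2 f2' (by fun_prop)
  · have e := funext fun x => (f1 x).deriv
    simp only [e, (f1' x).deriv]
    ring
  · have e := funext fun x => (f2 x).deriv
    simp only [e, (f2' x).deriv]
    ring
  · simp only [hinv]
    have e : ((m x).1 - 1, (m x).2) = jostOp a k μ V W m x := by
      ext
      · simpa [sub_eq_iff_eq_add'] using congrFun hm1 x
      · exact congrFun hm2 x
    rw [e]
    exact hT x
  · simp only [hinv, (d1 x).deriv, (d2 x).deriv]
    have hw := expWeight_pos δ L (x - a)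
    have hE := Real.exp_pos (-ρ * a)
    set N := D * Real.exp (-ρ * a) * expWeight δ L (x - a) with hN
    have hDv : 2 * (2 * (C * (1 + 1 / (ρ - γ)) * Real.exp (-ρ * a))) * expWeight δ L (x - a)
        ≤ 2 * N := by
      have h0 : 0 ≤ C * (1 + 1 / (ρ - γ)) * Real.exp (-ρ * a) * expWeight δ L (x - a) := by
        positivity
      have h1 : 2 ≤ 6 + 2 / (ρ - γ) + 4 * K := by
        have : 0 < 2 / (ρ - γ) := by positivity
        linarith
      have := mul_le_mul_of_nonneg_right h1 h0
      rw [hN, hD]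
      linarith
    have b1 := P.norm_bwdSol_potTerm_le P.pot zero_le_two hm P.re_fst x
    have b2 := P.norm_bwdSol_potTerm_le P.pot.symm zero_le_two hm P.re_snd x
    rw [← hv₁] at b1
    rw [← hv₂] at b2
    have hl : ‖-μ - Complex.I * k‖ ≤ 2 * (1 + ‖k‖) := by
      refine (norm_sub_le _ _).trans ?_
      rw [norm_neg, norm_mul, Complex.norm_I]
      linarith [P.norm_le]
    have hm2b : ‖(m x).2‖ ≤ 2 * N * (1 + ‖k‖)⁻¹ := by
      have h2 : (m x).2 = (jostOp a k μ V W m x).2 := congrFun hm2 x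
      rw [h2]
      refine (norm_snd_le _).trans ((hT x).trans (le_of_eq ?_))
      rw [hN]; ring
    have hN0 : 0 ≤ N := by
      have : 0 ≤ 2 * N * (1 + ‖k‖)⁻¹ := (norm_nonneg _).trans hm2b
      have h3 := inv_pos.2 hk
      by_contra! h
      nlinarith
    have hfin : 6 * (D * Real.exp (-ρ * a)) * expWeight δ L (x - a) = 6 * N := by rw [hN]; ring
    rw [hfin, Prod.norm_def]
    refine max_le (by dsimp only; linarith) ((norm_add_le _ _).trans ?_)
    have h4 : ‖(-μ - Complex.I * k) * (m x).2‖ ≤ 4 * N := by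
      rw [norm_mul]
      refine (mul_le_mul hl hm2b (norm_nonneg _) (by positivity)).trans (le_of_eq ?_)
      field_simp
      ring
    linarith

theorem expWeight_le_of_le {δ L L₀ a x₀ X : ℝ} (hδ : 0 ≤ δ) (hδL : δ ≤ L) (hX : x₀ ≤ X)
    (hL₀ : 0 ≤ L₀) (h : a = x₀ ∨ a = X ∧ L ≤ L₀) {x : ℝ} (hx : x₀ ≤ x) :
    expWeight δ L (x - a) ≤ Real.exp (L₀ * (X - x₀) + δ * X) * Real.exp (-δ * x) := by
  rw [← Real.exp_add]
  have h1 : 0 ≤ L₀ * (X - x₀) := mul_nonneg hL₀ (by linarith)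
  refine max_le (Real.exp_le_exp.2 ?_) (Real.exp_le_exp.2 ?_)
  · have : a ≤ X := by rcases h with h | h <;> linarith
    nlinarith
  · rcases h with rfl | ⟨rfl, hL⟩
    · nlinarith [mul_nonneg (sub_nonneg.2 hδL) (sub_nonneg.2 hx)]
    · rcases le_total x a with hxa | hxa
      · nlinarith [mul_nonneg (sub_nonneg.2 hL) (sub_nonneg.2 hxa),
          mul_nonneg hL₀ (sub_nonneg.2 hx), mul_nonneg hδ (sub_nonneg.2 hxa)]
      · nlinarith [mul_nonneg (sub_nonneg.2 hδL) (sub_nonneg.2 hxa)]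

/-- existence of the Jost solution `f₁(x,k)` of the linearized system
`H u⃗ = (k²+1) u⃗` on the strip `S₁ = {−γ/2 ≤ Im k ≤ 1 − ε₀}`, with
`m₁(x,k) = e^{−ikx} f₁(x,k)` close to `(1,0)` as `x → +∞`. -/
theorem stmt_6 (p γ ε₀ x₀ : ℝ) (hp : 1 < p) (hγ0 : 0 < γ) (hγ : γ < p - 1)
    (hε₀0 : 0 < ε₀) (hε₀1 : ε₀ < 1) :
    ∃ ε₁ > (0 : ℝ), ∃ C > (0 : ℝ), ∃ f₁ : ℝ → ℂ → ℂ × ℂ,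
      ∀ k : ℂ, -(γ / 2) ≤ k.im → k.im ≤ 1 - ε₀ →
        (ContDiff ℝ 2 (fun x : ℝ => (f₁ x k).1) ∧
         ContDiff ℝ 2 (fun x : ℝ => (f₁ x k).2)) ∧
        (∀ x : ℝ,
          (-(deriv (deriv (fun y : ℝ => (f₁ y k).1)) x) + (f₁ x k).1
            - ((((p + 1) / 2) * groundState p x ^ (p - 1) : ℝ) : ℂ) * (f₁ x k).1
            - ((((p - 1) / 2) * groundState p x ^ (p - 1) : ℝ) : ℂ) * (f₁ x k).2
            = (k ^ 2 + 1) * (f₁ x k).1) ∧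
          (deriv (deriv (fun y : ℝ => (f₁ y k).2)) x - (f₁ x k).2
            + ((((p - 1) / 2) * groundState p x ^ (p - 1) : ℝ) : ℂ) * (f₁ x k).1
            + ((((p + 1) / 2) * groundState p x ^ (p - 1) : ℝ) : ℂ) * (f₁ x k).2
            = (k ^ 2 + 1) * (f₁ x k).2)) ∧
        (∀ x : ℝ, x₀ ≤ x →
          ‖(Complex.exp (-(Complex.I * k * (x : ℂ))) * (f₁ x k).1 - 1,
            Complex.exp (-(Complex.I * k * (x : ℂ))) * (f₁ x k).2)‖
            ≤ C * (1 + ‖k‖)⁻¹ * Real.exp (-ε₁ * x) ∧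
          ‖(deriv (fun y : ℝ =>
              Complex.exp (-(Complex.I * k * (y : ℂ))) * (f₁ y k).1) x,
            deriv (fun y : ℝ =>
              Complex.exp (-(Complex.I * k * (y : ℂ))) * (f₁ y k).2) x)‖
            ≤ C * Real.exp (-ε₁ * x)) := by
  set ρ := p - 1 with hρ
  have hρ0 : 0 < ρ := by linarith
  have hργ : 0 < ρ - γ := by linarith
  set δ := min (ε₀ / 2) ρ with hδ
  have hδ0 : 0 < δ := lt_min (by linarith) hρ0
  have hδε : 2 * δ ≤ ε₀ := by linarith [min_le_left (ε₀ / 2) ρ]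
  have hδρ : δ ≤ ρ := min_le_right _ _
  set B := max 1 (γ / 2) with hB
  have hB1 : 1 ≤ B := le_max_left _ _
  set K := 1 + (3 * B + 1) / ε₀ with hK
  have hK0 : 0 < K := by positivity
  set C₀ := 2 * p * (p + 1) with hC₀
  have hC₀0 : 0 < C₀ := by positivity
  set D := (6 + 2 / (ρ - γ) + 4 * K) * (C₀ * (1 + 1 / (ρ - γ))) with hD
  have hD0 : 0 < D := by positivity
  obtain ⟨X, hX, hXD⟩ : ∃ X, x₀ ≤ X ∧ 2 * D * Real.exp (-ρ * X) ≤ 1 := by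
    have ht : Filter.Tendsto (fun X => 2 * D * Real.exp (-ρ * X)) Filter.atTop (nhds 0) := by
      simpa using (Real.tendsto_exp_atBot.comp
        (Filter.tendsto_id.const_mul_atTop_of_neg (neg_lt_zero.2 hρ0))).const_mul (2 * D)
    obtain ⟨X, h1, h2⟩ :=
      ((Filter.eventually_ge_atTop x₀).and (ht.eventually_le_const one_pos)).exists
    exact ⟨X, h1, h2⟩
  set E₀ := D * Real.exp (-ρ * x₀) with hE₀
  have hE₀0 : 0 < E₀ := by positivity
  let L : ℝ → ℝ := fun r => γ + 1 + ρ + Real.exp (ρ * X) + 4 * r + 4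
  set C₁ := Real.exp (L (2 * E₀) * (X - x₀) + δ * X) with hC₁
  have hC₁0 : 0 < C₁ := Real.exp_pos _
  have main : ∀ k : ℂ, ∃ f : ℝ → ℂ × ℂ, -(γ / 2) ≤ k.im → k.im ≤ 1 - ε₀ →
      (ContDiff ℝ 2 (fun x => (f x).1) ∧ ContDiff ℝ 2 (fun x => (f x).2)) ∧
      (∀ x, deriv (deriv fun y => (f y).1) x
          = -k ^ 2 * (f x).1 - (((((p + 1) / 2) * groundState p x ^ ρ : ℝ) : ℂ) * (f x).1
            + ((((p - 1) / 2) * groundState p x ^ ρ : ℝ) : ℂ) * (f x).2) ∧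
        deriv (deriv fun y => (f y).2) x
          = (k ^ 2 + 2) * (f x).2 - (((((p - 1) / 2) * groundState p x ^ ρ : ℝ) : ℂ) * (f x).1
            + ((((p + 1) / 2) * groundState p x ^ ρ : ℝ) : ℂ) * (f x).2)) ∧
      ∀ x : ℝ, x₀ ≤ x → ‖(Complex.exp (-(Complex.I * k * (x : ℂ))) * (f x).1 - 1,
            Complex.exp (-(Complex.I * k * (x : ℂ))) * (f x).2)‖
          ≤ 6 * E₀ * C₁ * (1 + ‖k‖)⁻¹ * Real.exp (-δ * x) ∧
        ‖(deriv (fun y : ℝ => Complex.exp (-(Complex.I * k * (y : ℂ))) * (f y).1) x,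
          deriv (fun y : ℝ => Complex.exp (-(Complex.I * k * (y : ℂ))) * (f y).2) x)‖
          ≤ 6 * E₀ * C₁ * Real.exp (-δ * x) := by
    intro k
    by_cases hk : -(γ / 2) ≤ k.im ∧ k.im ≤ 1 - ε₀
    swap
    · exact ⟨0, fun h1 h2 => absurd ⟨h1, h2⟩ hk⟩
    obtain ⟨hk1, hk2⟩ := hk
    obtain ⟨μ, hμ, hμ0, hgap, hμk, hkK⟩ :=
      exists_sqrt_gap hB1 hε₀0 hε₀1 (by linarith [le_max_right 1 (γ / 2)]) hk2
    obtain ⟨a, ha0, haX, hsmall, hcase⟩ : ∃ a, x₀ ≤ a ∧ a ≤ X ∧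
        2 * D * Real.exp (-ρ * a) ≤ 1 + ‖k‖ ∧ (a = x₀ ∨ a = X ∧ L ‖k‖ ≤ L (2 * E₀)) := by
      by_cases h : 2 * D * Real.exp (-ρ * x₀) ≤ 1 + ‖k‖
      · exact ⟨x₀, le_rfl, hX, h, Or.inl rfl⟩
      · refine ⟨X, hX, le_rfl, by linarith [norm_nonneg k], Or.inr ⟨rfl, ?_⟩⟩
        simp only [L]
        linarith
    have hexp := Real.exp_pos (ρ * X)
    have hone : 1 ≤ Real.exp (-ρ * a) * (L ‖k‖ - γ) := by
      have h1 : Real.exp (-ρ * a) * Real.exp (ρ * a) = 1 := by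
        rw [← Real.exp_add, ← Real.exp_zero]; ring_nf
      rw [← h1]
      refine mul_le_mul_of_nonneg_left ?_ (Real.exp_pos _).le
      have : Real.exp (ρ * a) ≤ Real.exp (ρ * X) := by gcongr
      simp only [L]
      linarith [norm_nonneg k]
    have P : JostParams a γ ρ δ C₀ K (L ‖k‖) k μ
        (fun x => (p + 1) / 2 * groundState p x ^ ρ)
        (fun x => (p - 1) / 2 * groundState p x ^ ρ) :=
      { pot := potDecay_groundState hp
        C_pos := hC₀0
        γ_pos := hγ0
        γ_lt := hγ
        δ_pos := hδ0
        δ_le := hδρ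
        ρ_le := by simp only [L]; linarith [norm_nonneg k]
        γ_add_one_le := by simp only [L]; linarith [norm_nonneg k]
        one_le := hone
        im_ge := hk1
        re_nonneg := hμ0
        gap := by linarith
        gap_le := by
          have h1 := (abs_le.1 (Complex.abs_im_le_norm k)).1
          have h2 := Complex.re_le_norm μ
          simp only [L]; linarith
        K_pos := hK0
        le_gap := hkK
        sq_eq := hμ
        norm_le := hμk }
    obtain ⟨f, hf1, hf2, hf3⟩ := P.exists_solution hD hsmall
    have hEa : D * Real.exp (-ρ * a) ≤ E₀ :=
      mul_le_mul_of_nonneg_left (Real.exp_le_exp.2 (by nlinarith)) hD0.le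
    refine ⟨f, fun _ _ => ⟨hf1, hf2, fun x hx => ?_⟩⟩
    have hw : expWeight δ (L ‖k‖) (x - a) ≤ C₁ * Real.exp (-δ * x) :=
      expWeight_le_of_le hδ0.le (hδρ.trans P.ρ_le) hX (by simp only [L]; positivity) hcase hx
    have hw0 := expWeight_pos δ (L ‖k‖) (x - a)
    refine ⟨(hf3 x).1.trans ?_, (hf3 x).2.trans ?_⟩
    · calc _ ≤ 6 * E₀ * (1 + ‖k‖)⁻¹ * (C₁ * Real.exp (-δ * x)) := by gcongr; norm_num
        _ = _ := by ring
    · calc _ ≤ 6 * E₀ * (C₁ * Real.exp (-δ * x)) := by gcongr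
        _ = _ := by ring
  choose f hf using main
  refine ⟨δ, hδ0, 6 * E₀ * C₁, by positivity, fun x k => f k x, fun k hk1 hk2 => ?_⟩
  obtain ⟨h1, h2, h3⟩ := hf k hk1 hk2
  refine ⟨h1, fun x => ⟨?_, ?_⟩, h3⟩
  · rw [(h2 x).1]; ring
  · rw [(h2 x).2]; ring
end

section
/- Let k ∈ ℂ with 1 − k² − 2ik ≠ 0, and define u(x) = e^{ikx}(1 − k² − 2ik)^{−1}·(1 − k² − 2ik·tanh(x) − sech²(x)) and v(x) = e^{ikx}(1 − k² − 2ik)^{−1}·(−sech²(x)). Then for all x ∈ ℝ: −u''(x) + u(x) − 4·sech²(x)·u(x) − 2·sech²(x)·v(x) = (k²+1)·u(x) and v''(x) − v(x) + 2·sech²(x)·u(x) + 4·sech²(x)·v(x) = (k²+1)·v(x). -/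
/-- The function `x ↦ c e^{ax} p(tanh x)` attached to a polynomial `p`. -/
noncomputable def expMulPolyTanh (a c : ℂ) (p : Polynomial ℂ) (x : ℝ) : ℂ :=
  Complex.exp (a * (x : ℂ)) * c * p.eval (Real.tanh x : ℂ)

theorem inv_cosh_sq_ofReal (x : ℝ) :
    ((Real.cosh x : ℂ))⁻¹ ^ 2 = 1 - (Real.tanh x : ℂ) ^ 2 := by
  have hc : Real.cosh x ≠ 0 := (Real.cosh_pos x).ne'
  have h : (Real.cosh x)⁻¹ ^ 2 = 1 - Real.tanh x ^ 2 := by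
    rw [Real.tanh_eq_sinh_div_cosh]
    field_simp
    linarith [Real.cosh_sq x]
  exact_mod_cast h

theorem hasDerivAt_ofReal_tanh (x : ℝ) :
    HasDerivAt (fun y : ℝ => (Real.tanh y : ℂ)) (1 - (Real.tanh x : ℂ) ^ 2) x := by
  have hc : Real.cosh x ≠ 0 := (Real.cosh_pos x).ne'
  have h : HasDerivAt Real.tanh (1 - Real.tanh x ^ 2) x := by
    have h := (Real.hasDerivAt_sinh x).div (Real.hasDerivAt_cosh x) hc
    rw [show Real.tanh = Real.sinh / Real.cosh from funext Real.tanh_eq_sinh_div_cosh]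
    refine h.congr_deriv ?_
    rw [Pi.div_apply]
    field_simp
  simpa using h.ofReal_comp

open Polynomial in
/-- Differentiation preserves the class of functions `c e^{ax} p(tanh x)`. -/
theorem deriv_expMulPolyTanh (a c : ℂ) (p : ℂ[X]) :
    deriv (expMulPolyTanh a c p) =
      expMulPolyTanh a c (C a * p + derivative p * (1 - X ^ 2)) := by
  funext x
  have he : HasDerivAt (fun y : ℝ => Complex.exp (a * (y : ℂ)))
      (Complex.exp (a * (x : ℂ)) * (a * 1)) x :=
    ((hasDerivAt_id x).ofReal_comp.const_mul a).cexp
  have hp := (p.hasDerivAt (Real.tanh x : ℂ)).comp x (hasDerivAt_ofReal_tanh x)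
  refine ((he.mul_const c).mul hp).deriv.trans ?_
  simp only [expMulPolyTanh, Function.comp_apply, eval_add, eval_mul, eval_sub, eval_pow,
    eval_one, eval_X, eval_C]
  ring

open Complex in
/-- the explicit Jost solution `f₁(x,k)` at `p = 3` solves the
linearized system `H u⃗ = (k²+1) u⃗` at the cubic NLS ground state. -/
theorem stmt_7 (k : ℂ) (hk : 1 - k ^ 2 - 2 * I * k ≠ 0)
    (u v : ℝ → ℂ)
    (hu : u = fun x : ℝ => Complex.exp (I * k * (x : ℂ)) * (1 - k ^ 2 - 2 * I * k)⁻¹ *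
      (1 - k ^ 2 - 2 * I * k * (Real.tanh x : ℂ) - ((Real.cosh x : ℂ))⁻¹ ^ 2))
    (hv : v = fun x : ℝ => Complex.exp (I * k * (x : ℂ)) * (1 - k ^ 2 - 2 * I * k)⁻¹ *
      (-(((Real.cosh x : ℂ))⁻¹ ^ 2))) :
    ∀ x : ℝ,
      (-(deriv (deriv u) x) + u x
        - 4 * ((Real.cosh x : ℂ))⁻¹ ^ 2 * u x
        - 2 * ((Real.cosh x : ℂ))⁻¹ ^ 2 * v x = (k ^ 2 + 1) * u x) ∧
      (deriv (deriv v) x - v x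
        + 2 * ((Real.cosh x : ℂ))⁻¹ ^ 2 * u x
        + 4 * ((Real.cosh x : ℂ))⁻¹ ^ 2 * v x = (k ^ 2 + 1) * v x) := by
  have hu' : u = expMulPolyTanh (I * k) (1 - k ^ 2 - 2 * I * k)⁻¹
      ((Polynomial.X - Polynomial.C (I * k)) ^ 2) := by
    funext x
    simp only [hu, expMulPolyTanh, inv_cosh_sq_ofReal, Polynomial.eval_pow, Polynomial.eval_sub,
      Polynomial.eval_X, Polynomial.eval_C]
    congr 1
    linear_combination -k ^ 2 * I_sq
  have hv' : v = expMulPolyTanh (I * k) (1 - k ^ 2 - 2 * I * k)⁻¹ (Polynomial.X ^ 2 - 1) := by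
    funext x
    simp only [hv, expMulPolyTanh, inv_cosh_sq_ofReal, Polynomial.eval_pow, Polynomial.eval_sub,
      Polynomial.eval_X, Polynomial.eval_one]
    ring
  intro x
  rw [hu', hv']
  simp only [deriv_expMulPolyTanh, expMulPolyTanh, inv_cosh_sq_ofReal]
  generalize Complex.exp (I * k * (x : ℂ)) * (1 - k ^ 2 - 2 * I * k)⁻¹ = e
  generalize (Real.tanh x : ℂ) = t
  have ha : (I * k) ^ 2 = -k ^ 2 := by linear_combination k ^ 2 * I_sq
  generalize I * k = a at ha ⊢
  simp only [pow_two (Polynomial.X - Polynomial.C a), pow_two Polynomial.X,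
    Polynomial.derivative_add, Polynomial.derivative_sub, Polynomial.derivative_mul,
    Polynomial.derivative_X, Polynomial.derivative_C, Polynomial.derivative_one,
    Polynomial.derivative_zero, Polynomial.eval_add, Polynomial.eval_sub, Polynomial.eval_mul,
    Polynomial.eval_X, Polynomial.eval_C, Polynomial.eval_one, Polynomial.eval_zero]
  constructor
  · linear_combination -e * (t - a) ^ 2 * ha
  · linear_combination e * (1 - t ^ 2) * ha
end

section
/- The functions u(x) = 1 − sech²(x) and v(x) = −sech²(x) satisfy for all x ∈ ℝ: −u''(x) + u(x) − 4·sech²(x)·u(x) − 2·sech²(x)·v(x) = u(x) and v''(x) − v(x) + 2·sech²(x)·u(x) + 4·sech²(x)·v(x) = v(x). (That is, (1 − sech², −sech²) is a bounded eigenvector with eigenvalue λ = 1 of the linearization at the cubic NLS ground state.) -/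
theorem hasDerivAt_sech_sq (x : ℝ) :
    HasDerivAt (fun y : ℝ => ((Real.cosh y)⁻¹) ^ 2)
      (-2 * Real.sinh x * ((Real.cosh x)⁻¹) ^ 3) x := by
  have hx := (Real.cosh_pos x).ne'
  refine (((Real.hasDerivAt_cosh x).fun_inv hx).fun_pow 2).congr_deriv ?_
  norm_num
  field_simp

theorem deriv_sech_sq :
    deriv (fun y : ℝ => ((Real.cosh y)⁻¹) ^ 2) =
      fun x => -2 * Real.sinh x * ((Real.cosh x)⁻¹) ^ 3 :=
  funext fun x => (hasDerivAt_sech_sq x).deriv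

theorem deriv_deriv_sech_sq (x : ℝ) :
    deriv (deriv (fun y : ℝ => ((Real.cosh y)⁻¹) ^ 2)) x =
      4 * ((Real.cosh x)⁻¹) ^ 2 - 6 * (((Real.cosh x)⁻¹) ^ 2) ^ 2 := by
  have hx := (Real.cosh_pos x).ne'
  rw [deriv_sech_sq]
  refine ((((Real.hasDerivAt_sinh x).const_mul (-2)).fun_mul
    (((Real.hasDerivAt_cosh x).fun_inv hx).fun_pow 3)).congr_deriv ?_).deriv
  norm_num
  field_simp
  linear_combination (-6) * Real.cosh_sq x

/-- `(1 − sech², −sech²)` is a bounded eigenvector with eigenvalue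
`λ = 1` of the linearization at the cubic NLS ground state. -/
theorem stmt_10 (u v : ℝ → ℝ)
    (hu : u = fun x : ℝ => 1 - ((Real.cosh x)⁻¹) ^ 2)
    (hv : v = fun x : ℝ => -(((Real.cosh x)⁻¹) ^ 2)) :
    ∀ x : ℝ,
      (-(deriv (deriv u) x) + u x
        - 4 * ((Real.cosh x)⁻¹) ^ 2 * u x
        - 2 * ((Real.cosh x)⁻¹) ^ 2 * v x = u x) ∧
      (deriv (deriv v) x - v x
        + 2 * ((Real.cosh x)⁻¹) ^ 2 * u x
        + 4 * ((Real.cosh x)⁻¹) ^ 2 * v x = v x) := by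
  intro x
  have hu' : deriv (deriv u) x =
      -(4 * ((Real.cosh x)⁻¹) ^ 2 - 6 * (((Real.cosh x)⁻¹) ^ 2) ^ 2) := by
    rw [← deriv_deriv_sech_sq, hu, deriv_const_sub', deriv.fun_neg]
  have hv' : deriv (deriv v) x =
      -(4 * ((Real.cosh x)⁻¹) ^ 2 - 6 * (((Real.cosh x)⁻¹) ^ 2) ^ 2) := by
    rw [← deriv_deriv_sech_sq, hv, deriv.fun_neg', deriv.fun_neg]
  rw [hu', hv', hu, hv]
  constructor <;> ring
end

section
/- For every a ∈ ℝ, ∫_ℝ cos(a·x)·sech(x) dx = π·sech(π·a/2). -/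
open MeasureTheory

lemma Real.sigmoid_two_mul (x : ℝ) :
    Real.sigmoid (2 * x) = Real.exp (x - Real.log (2 * Real.cosh x)) := by
  have hc := Real.cosh_pos x
  rw [Real.exp_sub, Real.exp_log (by positivity), Real.sigmoid_def, Real.cosh_eq,
    show -(2 * x) = -x + -x by ring, Real.exp_add, Real.exp_neg]
  have := Real.exp_pos x
  field_simp

lemma Real.one_sub_sigmoid_two_mul (x : ℝ) :
    1 - Real.sigmoid (2 * x) = Real.exp (-x - Real.log (2 * Real.cosh x)) := by
  rw [← Real.sigmoid_neg, ← mul_neg, Real.sigmoid_two_mul, Real.cosh_neg]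

/-- The pullback of the integrand of `B(u, 1 - u)` under `x ↦ sigmoid (2 * x)`. -/
lemma abs_deriv_smul_betaIntegrand_sigmoid (u : ℂ) (x : ℝ) :
    |2 * (Real.sigmoid (2 * x) * (1 - Real.sigmoid (2 * x)))| •
      (((Real.sigmoid (2 * x) : ℝ) : ℂ) ^ (u - 1) *
        (1 - ((Real.sigmoid (2 * x) : ℝ) : ℂ)) ^ (1 - u - 1)) =
      Complex.exp ((2 * u - 1) * x) * ((Real.cosh x)⁻¹ : ℝ) := by
  have hc := Real.cosh_pos x
  rw [← Complex.ofReal_one, ← Complex.ofReal_sub, Real.one_sub_sigmoid_two_mul,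
    Real.sigmoid_two_mul, ← Real.exp_add, abs_of_pos (by positivity)]
  set l := Real.log (2 * Real.cosh x) with hl
  have hcosh : Real.cosh x = Real.exp l / 2 := by
    rw [hl, Real.exp_log (by positivity)]; ring
  rw [hcosh, Complex.cpow_def_of_ne_zero (by exact_mod_cast (Real.exp_pos _).ne'),
    Complex.cpow_def_of_ne_zero (by exact_mod_cast (Real.exp_pos _).ne'),
    ← Complex.ofReal_log (Real.exp_pos _).le, ← Complex.ofReal_log (Real.exp_pos _).le,
    Real.log_exp, Real.log_exp, inv_div, div_eq_mul_inv, ← Real.exp_neg, Complex.real_smul]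
  push_cast
  rw [← Complex.exp_add, mul_assoc, ← Complex.exp_add, mul_left_comm, ← Complex.exp_add]
  ring_nf

lemma image_sigmoid_two_mul : (fun x : ℝ => Real.sigmoid (2 * x)) '' Set.univ = Set.Ioo 0 1 := by
  rw [Set.image_univ, ← Real.range_sigmoid]
  exact (mul_left_surjective₀ two_ne_zero).range_comp Real.sigmoid

lemma hasDerivAt_sigmoid_two_mul (x : ℝ) :
    HasDerivAt (fun x : ℝ => Real.sigmoid (2 * x))
      (2 * (Real.sigmoid (2 * x) * (1 - Real.sigmoid (2 * x)))) x := by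
  simpa [mul_comm, Function.comp_def] using
    (Real.hasDerivAt_sigmoid (2 * x)).comp x ((hasDerivAt_id x).const_mul 2)

lemma injOn_sigmoid_two_mul : Set.InjOn (fun x : ℝ => Real.sigmoid (2 * x)) Set.univ :=
  (Real.sigmoid_injective.comp (mul_right_injective₀ two_ne_zero)).injOn

lemma integrable_exp_mul_inv_cosh {u : ℂ} (h₀ : 0 < u.re) (h₁ : u.re < 1) :
    Integrable fun x : ℝ => Complex.exp ((2 * u - 1) * x) * ((Real.cosh x)⁻¹ : ℝ) := by
  have h := Complex.betaIntegral_convergent (u := u) (v := 1 - u) h₀ (by simpa using h₁)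
  rw [intervalIntegrable_iff_integrableOn_Ioo_of_le zero_le_one, ← image_sigmoid_two_mul,
    integrableOn_image_iff_integrableOn_abs_deriv_smul MeasurableSet.univ
      (fun x _ => (hasDerivAt_sigmoid_two_mul x).hasDerivWithinAt) injOn_sigmoid_two_mul,
    integrableOn_univ] at h
  simpa only [abs_deriv_smul_betaIntegrand_sigmoid] using h

lemma integral_exp_mul_inv_cosh {u : ℂ} (h₀ : 0 < u.re) (h₁ : u.re < 1) :
    ∫ x : ℝ, Complex.exp ((2 * u - 1) * x) * ((Real.cosh x)⁻¹ : ℝ) =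
      Real.pi / Complex.sin (Real.pi * u) := by
  have h := Complex.Gamma_mul_Gamma_eq_betaIntegral (s := u) (t := 1 - u) h₀ (by simpa using h₁)
  rw [Complex.Gamma_mul_Gamma_one_sub, add_sub_cancel, Complex.Gamma_one, one_mul,
    Complex.betaIntegral, intervalIntegral.integral_of_le zero_le_one,
    integral_Ioc_eq_integral_Ioo, ← image_sigmoid_two_mul,
    integral_image_eq_integral_abs_deriv_smul MeasurableSet.univ
      (fun x _ => (hasDerivAt_sigmoid_two_mul x).hasDerivWithinAt) injOn_sigmoid_two_mul,
    setIntegral_univ] at h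
  simpa only [abs_deriv_smul_betaIntegrand_sigmoid] using h.symm

/-- `∫_ℝ cos(ax) sech(x) dx = π sech(πa/2)`. -/
theorem stmt_13 (a : ℝ) :
    ∫ x : ℝ, Real.cos (a * x) * (Real.cosh x)⁻¹
      = Real.pi * (Real.cosh (Real.pi * a / 2))⁻¹ := by
  set u : ℂ := (1 + a * Complex.I) / 2 with hu
  have hre : u.re = 1 / 2 := by simp [hu]
  have h₀ : 0 < u.re := by rw [hre]; norm_num
  have h₁ : u.re < 1 := by rw [hre]; norm_num
  have hexp (x : ℝ) : (Complex.exp ((2 * u - 1) * x) * ((Real.cosh x)⁻¹ : ℝ)).re =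
      Real.cos (a * x) * (Real.cosh x)⁻¹ := by
    rw [Complex.re_mul_ofReal, show (2 * u - 1) * x = ((a * x : ℝ) : ℂ) * Complex.I by
      rw [hu]; push_cast; ring, Complex.exp_ofReal_mul_I_re]
  have hsin : Complex.sin (Real.pi * u) = (Real.cosh (Real.pi * a / 2) : ℝ) := by
    rw [show (Real.pi : ℂ) * u = ((Real.pi * a / 2 : ℝ) : ℂ) * Complex.I + Real.pi / 2 by
      rw [hu]; push_cast; ring, Complex.sin_add_pi_div_two, Complex.cos_mul_I,
      Complex.ofReal_cosh]
  have h := congrArg Complex.re (integral_exp_mul_inv_cosh h₀ h₁)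
  rw [hsin, ← Complex.ofReal_div, Complex.ofReal_re, div_eq_mul_inv] at h
  rw [← h]
  simpa only [RCLike.re_to_complex, hexp] using
    integral_re (integrable_exp_mul_inv_cosh h₀ h₁)
end

section
/- For every a ∈ ℝ and every integer n ≥ 1, ∫_ℝ cos(a·x)·sech(x)^{n+2} dx = ((n² + a²)/(n² + n)) · ∫_ℝ cos(a·x)·sech(x)^n dx. -/
open MeasureTheory

theorem one_add_sq_le_two_mul_cosh (x : ℝ) : 1 + x ^ 2 ≤ 2 * Real.cosh x := by
  have h2 : Real.cosh x = 1 + 2 * Real.sinh (x / 2) ^ 2 := by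
    have h := Real.cosh_two_mul (x / 2)
    rw [mul_div_cancel₀ x two_ne_zero, Real.cosh_sq] at h
    linarith
  have h3 : (x / 2) ^ 2 ≤ Real.sinh (x / 2) ^ 2 := by
    rcases le_total 0 (x / 2) with h | h
    · have := Real.self_le_sinh_iff.2 h
      nlinarith
    · have := Real.sinh_le_self_iff.2 h
      nlinarith
  nlinarith

theorem integrable_inv_cosh_pow {n : ℕ} (hn : 1 ≤ n) :
    Integrable fun x : ℝ => ((Real.cosh x)⁻¹) ^ n := by
  have hc : Continuous fun x : ℝ => (Real.cosh x)⁻¹ ^ n :=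
    (Real.continuous_cosh.inv₀ fun x => (Real.cosh_pos x).ne').pow n
  refine (integrable_inv_one_add_sq.const_mul 2).mono' hc.aestronglyMeasurable
    (Filter.Eventually.of_forall fun x => ?_)
  have hpos := Real.cosh_pos x
  rw [Real.norm_of_nonneg (by positivity)]
  calc (Real.cosh x)⁻¹ ^ n ≤ (Real.cosh x)⁻¹ ^ 1 :=
        pow_le_pow_of_le_one (by positivity) (inv_le_one_of_one_le₀ (Real.one_le_cosh x)) hn
    _ ≤ 2 * (1 + x ^ 2)⁻¹ := by
        rw [pow_one, ← div_eq_mul_inv, inv_eq_one_div, div_le_div_iff₀ hpos (by positivity)]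
        linarith [one_add_sq_le_two_mul_cosh x]

theorem integrable_bounded_mul_inv_cosh_pow {n : ℕ} (hn : 1 ≤ n) {f : ℝ → ℝ}
    (hf : Continuous f) {C : ℝ} (hC : ∀ x, |f x| ≤ C) :
    Integrable fun x : ℝ => f x * ((Real.cosh x)⁻¹) ^ n :=
  (integrable_inv_cosh_pow hn).bdd_mul hf.aestronglyMeasurable
    (Filter.Eventually.of_forall hC)

theorem abs_sinh_mul_inv_cosh_le_one (x : ℝ) : |Real.sinh x * (Real.cosh x)⁻¹| ≤ 1 := by
  have hpos := Real.cosh_pos x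
  rw [abs_mul, abs_inv, abs_of_pos hpos, ← div_eq_mul_inv, div_le_one hpos]
  exact abs_le_of_sq_le_sq (by linarith [Real.cosh_sq x]) hpos.le

theorem hasDerivAt_wronskian_cos_inv_cosh_pow (a : ℝ) {n : ℕ} (hn : 1 ≤ n) (x : ℝ) :
    HasDerivAt
      (fun x => (a * Real.sin (a * x) -
        n * (Real.cos (a * x) * (Real.sinh x * (Real.cosh x)⁻¹))) * (Real.cosh x)⁻¹ ^ n)
      (((n : ℝ) ^ 2 + a ^ 2) * (Real.cos (a * x) * (Real.cosh x)⁻¹ ^ n) -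
        ((n : ℝ) ^ 2 + n) * (Real.cos (a * x) * (Real.cosh x)⁻¹ ^ (n + 2))) x := by
  have hne := (Real.cosh_pos x).ne'
  have hax : HasDerivAt (fun x : ℝ => a * x) a x := by
    simpa using (hasDerivAt_id x).const_mul a
  have hinv := (Real.hasDerivAt_cosh x).fun_inv hne
  have hG := ((hax.sin.const_mul a).fun_sub
    ((hax.cos.fun_mul ((Real.hasDerivAt_sinh x).fun_mul hinv)).const_mul (n : ℝ))).fun_mul
      (hinv.fun_pow n)
  refine hG.congr_deriv ?_
  obtain ⟨m, rfl⟩ := Nat.exists_eq_add_of_le' hn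
  rw [Nat.add_sub_cancel]
  push_cast
  simp only [pow_add]
  generalize (Real.cosh x)⁻¹ ^ m = p
  have hsq : Real.sinh x ^ 2 = Real.cosh x ^ 2 - 1 := by linarith [Real.cosh_sq x]
  field_simp
  ring_nf
  simp only [hsq]
  ring

/-- the reduction formula
`∫ cos(ax) sech^{n+2}(x) dx = ((n²+a²)/(n²+n)) ∫ cos(ax) sech^n(x) dx`. -/
theorem stmt_14 (a : ℝ) (n : ℕ) (hn : 1 ≤ n) :
    ∫ x : ℝ, Real.cos (a * x) * ((Real.cosh x)⁻¹) ^ (n + 2)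
      = (((n : ℝ) ^ 2 + a ^ 2) / ((n : ℝ) ^ 2 + n)) *
          ∫ x : ℝ, Real.cos (a * x) * ((Real.cosh x)⁻¹) ^ n := by
  have hcos {m : ℕ} (hm : 1 ≤ m) :
      Integrable fun x : ℝ => Real.cos (a * x) * (Real.cosh x)⁻¹ ^ m :=
    integrable_bounded_mul_inv_cosh_pow hm (by fun_prop) fun x => Real.abs_cos_le_one _
  have hn₀ := (hcos hn).const_mul ((n : ℝ) ^ 2 + a ^ 2)
  have hn₂ := (hcos (show 1 ≤ n + 2 by omega)).const_mul ((n : ℝ) ^ 2 + n)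
  have htanh : Continuous fun x : ℝ => Real.sinh x * (Real.cosh x)⁻¹ :=
    Real.continuous_sinh.mul (Real.continuous_cosh.inv₀ fun x => (Real.cosh_pos x).ne')
  have hbound (x : ℝ) : |a * Real.sin (a * x) -
      n * (Real.cos (a * x) * (Real.sinh x * (Real.cosh x)⁻¹))| ≤ |a| + n := by
    refine (abs_sub _ _).trans (add_le_add ?_ ?_)
    · rw [abs_mul]
      exact mul_le_of_le_one_right (abs_nonneg a) (Real.abs_sin_le_one _)
    · rw [abs_mul, abs_mul, Nat.abs_cast]
      exact mul_le_of_le_one_right n.cast_nonneg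
        (mul_le_one₀ (Real.abs_cos_le_one _) (abs_nonneg _) (abs_sinh_mul_inv_cosh_le_one x))
  have key := integral_eq_zero_of_hasDerivAt_of_integrable
    (hasDerivAt_wronskian_cos_inv_cosh_pow a hn) (hn₀.sub hn₂)
    (integrable_bounded_mul_inv_cosh_pow hn (by fun_prop) hbound)
  rw [integral_sub hn₀ hn₂, integral_const_mul, integral_const_mul] at key
  have hpos : (0 : ℝ) < (n : ℝ) ^ 2 + n := by positivity
  rw [div_mul_eq_mul_div, eq_div_iff hpos.ne']
  linarith
end

section
/- The function x ↦ cos(x)·(x·tanh(x) − log(e^x + e^{−x}))·cosh(x) is integrable on ℝ, and ∫_ℝ cos(x)·(x·tanh(x) − log(e^x + e^{−x}))·cosh(x) dx < 0. -/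
open MeasureTheory

open Set Filter Topology

/-- The even function `x ↦ cosh x log(eˣ + e⁻ˣ) - x sinh x`. -/
noncomputable def coshLog (x : ℝ) : ℝ :=
  Real.cosh x * Real.log (Real.exp x + Real.exp (-x)) - x * Real.sinh x

/-- The derivative of `coshLog`. -/
noncomputable def coshLogDeriv (x : ℝ) : ℝ :=
  Real.sinh x * Real.log (Real.exp x + Real.exp (-x)) - x * Real.cosh x

lemma integrand_eq_neg_cos_mul_coshLog (x : ℝ) :
    Real.cos x * (x * Real.tanh x - Real.log (Real.exp x + Real.exp (-x))) * Real.cosh x =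
      -(Real.cos x * coshLog x) := by
  have h := (Real.cosh_pos x).ne'
  rw [Real.tanh_eq_sinh_div_cosh, coshLog]
  field_simp
  ring

lemma continuous_coshLog : Continuous coshLog := by
  unfold coshLog
  refine (Real.continuous_cosh.mul (Continuous.log (by fun_prop) fun x => ?_)).sub
    (continuous_id.mul Real.continuous_sinh)
  positivity

lemma coshLog_abs (x : ℝ) : coshLog |x| = coshLog x := by
  rcases abs_choice x with h | h <;> rw [h]
  simp only [coshLog, Real.cosh_neg, Real.sinh_neg, neg_neg, add_comm (Real.exp (-x))]
  ring

lemma hasDerivAt_log_exp_add_exp_neg (x : ℝ) :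
    HasDerivAt (fun x => Real.log (Real.exp x + Real.exp (-x)))
      (Real.sinh x / Real.cosh x) x := by
  have h := ((Real.hasDerivAt_exp x).add ((hasDerivAt_neg x).exp)).log
    (by positivity : Real.exp x + Real.exp (-x) ≠ 0)
  refine h.congr_deriv ?_
  simp only [Pi.add_apply, Real.sinh_eq, Real.cosh_eq]
  field_simp
  ring

lemma hasDerivAt_coshLog (x : ℝ) : HasDerivAt coshLog (coshLogDeriv x) x := by
  have h := ((Real.hasDerivAt_cosh x).mul (hasDerivAt_log_exp_add_exp_neg x)).sub
    ((hasDerivAt_id x).mul (Real.hasDerivAt_sinh x))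
  refine h.congr_deriv ?_
  have := (Real.cosh_pos x).ne'
  simp only [coshLogDeriv, id]
  field_simp
  ring

lemma hasDerivAt_coshLogDeriv (x : ℝ) :
    HasDerivAt coshLogDeriv (coshLog x - 1 / Real.cosh x) x := by
  have h := ((Real.hasDerivAt_sinh x).mul (hasDerivAt_log_exp_add_exp_neg x)).sub
    ((hasDerivAt_id x).mul (Real.hasDerivAt_cosh x))
  refine h.congr_deriv ?_
  have := (Real.cosh_pos x).ne'
  have hs := Real.cosh_sq x
  simp only [coshLog, id]
  field_simp
  linear_combination -hs

lemma le_log_exp_add_exp_neg (x : ℝ) : x ≤ Real.log (Real.exp x + Real.exp (-x)) := by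
  rw [Real.le_log_iff_exp_le (by positivity)]
  linarith [Real.exp_pos (-x)]

lemma log_exp_add_exp_neg_le (x : ℝ) :
    Real.log (Real.exp x + Real.exp (-x)) ≤ x + Real.exp (-x) * Real.exp (-x) := by
  have h : Real.exp x + Real.exp (-x) =
      Real.exp x * (1 + Real.exp (-x) * Real.exp (-x)) := by
    have : Real.exp x * Real.exp (-x) = 1 := by rw [← Real.exp_add]; simp
    linear_combination -Real.exp (-x) * this
  rw [h, Real.log_mul (by positivity) (by positivity), Real.log_exp]
  have := Real.log_le_sub_one_of_pos
    (by positivity : 0 < 1 + Real.exp (-x) * Real.exp (-x))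
  linarith

lemma one_add_mul_exp_neg_le (x : ℝ) :
    (1 + x) * Real.exp (-x) ≤ 2 * Real.exp (-(1 / 2) * x) := by
  have h1 : Real.exp (-x) = Real.exp (-(1 / 2) * x) * Real.exp (-(1 / 2) * x) := by
    rw [← Real.exp_add]; ring_nf
  have h2 : Real.exp (x / 2) * Real.exp (-(1 / 2) * x) = 1 := by
    rw [← Real.exp_add]; ring_nf; simp
  have h3 := Real.add_one_le_exp (x / 2)
  have h4 := Real.exp_pos (-(1 / 2) * x)
  have h5 := mul_le_mul_of_nonneg_right h3 h4.le
  rw [h1]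
  nlinarith

lemma abs_coshLog_le {x : ℝ} (hx : 0 ≤ x) :
    |coshLog x| ≤ 2 * Real.exp (-(1 / 2) * x) := by
  refine le_trans ?_ (one_add_mul_exp_neg_le x)
  have hc := Real.cosh_pos x
  have h1 := mul_le_mul_of_nonneg_left (le_log_exp_add_exp_neg x) hc.le
  have h2 := mul_le_mul_of_nonneg_left (log_exp_add_exp_neg_le x) hc.le
  have he : Real.exp x * Real.exp (-x) = 1 := by rw [← Real.exp_add]; simp
  have hp := Real.exp_pos (-x)
  have hle : Real.exp (-x) ≤ Real.exp x := Real.exp_le_exp.2 (by linarith)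
  have hcs : Real.cosh x - Real.sinh x = Real.exp (-x) := Real.cosh_sub_sinh x
  have hce : Real.cosh x ≤ Real.exp x := by rw [Real.cosh_eq]; linarith
  have h3 : Real.cosh x * (Real.exp (-x) * Real.exp (-x)) ≤ Real.exp (-x) := by
    have := mul_le_mul_of_nonneg_right hce (mul_pos hp hp).le
    rwa [← mul_assoc (Real.exp x), he, one_mul] at this
  have h4 : x * Real.cosh x - x * Real.sinh x = x * Real.exp (-x) := by rw [← hcs]; ring
  have h5 := mul_nonneg hx hp.le
  rw [coshLog, abs_le]
  constructor <;> linarith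

lemma abs_coshLogDeriv_le {x : ℝ} (hx : 0 ≤ x) :
    |coshLogDeriv x| ≤ 2 * Real.exp (-(1 / 2) * x) := by
  refine le_trans ?_ (one_add_mul_exp_neg_le x)
  have hs := Real.sinh_nonneg_iff.2 hx
  have h1 := mul_le_mul_of_nonneg_left (le_log_exp_add_exp_neg x) hs
  have h2 := mul_le_mul_of_nonneg_left (log_exp_add_exp_neg_le x) hs
  have he : Real.exp x * Real.exp (-x) = 1 := by rw [← Real.exp_add]; simp
  have hp := Real.exp_pos (-x)
  have hcs : Real.cosh x - Real.sinh x = Real.exp (-x) := Real.cosh_sub_sinh x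
  have hse : Real.sinh x ≤ Real.exp x := by rw [Real.sinh_eq]; linarith [Real.exp_pos x]
  have h3 : Real.sinh x * (Real.exp (-x) * Real.exp (-x)) ≤ Real.exp (-x) := by
    have := mul_le_mul_of_nonneg_right hse (mul_pos hp hp).le
    rwa [← mul_assoc (Real.exp x), he, one_mul] at this
  have h4 : x * Real.cosh x - x * Real.sinh x = x * Real.exp (-x) := by rw [← hcs]; ring
  have h5 := mul_nonneg hx hp.le
  rw [coshLogDeriv, abs_le]
  constructor <;> linarith

lemma integrable_exp_neg_half_mul_abs :
    Integrable (fun x : ℝ => Real.exp (-(1 / 2) * |x|)) := by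
  refine Integrable.of_integral_ne_zero ?_
  rw [integral_comp_abs (f := fun x => Real.exp (-(1 / 2) * x)),
    integral_exp_mul_Ioi (by norm_num)]
  norm_num

lemma integrable_cos_mul_coshLog : Integrable (fun x => Real.cos x * coshLog x) := by
  refine (integrable_exp_neg_half_mul_abs.const_mul 2).mono'
    (Real.continuous_cos.mul continuous_coshLog).aestronglyMeasurable (.of_forall fun x => ?_)
  rw [Real.norm_eq_abs, abs_mul, ← coshLog_abs x]
  have h1 := abs_coshLog_le (abs_nonneg x)
  have h2 := mul_le_mul_of_nonneg_right (Real.abs_cos_le_one x) (abs_nonneg (coshLog |x|))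
  linarith

/-- Truncating the geometric expansion of `1 / cosh x` in powers of `exp (-x)`. -/
lemma le_cos_mul_one_div_cosh {x : ℝ} (hx : 0 ≤ x) :
    2 * Real.exp (-x) * Real.cos x - 2 * Real.exp (-3 * x) * Real.cos x
      - 2 * Real.exp (-5 * x) + Real.exp (-7 * x) ≤ Real.cos x * (1 / Real.cosh x) := by
  have e3 : Real.exp (-3 * x) = Real.exp (-x) ^ 3 := by
    rw [← Real.exp_nat_mul]; ring_nf
  have e5 : Real.exp (-5 * x) = Real.exp (-x) ^ 5 := by
    rw [← Real.exp_nat_mul]; ring_nf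
  have e7 : Real.exp (-7 * x) = Real.exp (-x) ^ 7 := by
    rw [← Real.exp_nat_mul]; ring_nf
  have hp := Real.exp_pos (-x)
  have hp1 : Real.exp (-x) ≤ 1 := Real.exp_le_one_iff.2 (by linarith)
  have he : Real.exp x = (Real.exp (-x))⁻¹ := by rw [Real.exp_neg, inv_inv]
  rw [e3, e5, e7, Real.cosh_eq, he]
  have hc := Real.neg_one_le_cos x
  generalize Real.exp (-x) = p at *
  generalize Real.cos x = c at *
  have hd : c * (1 / ((p⁻¹ + p) / 2)) = 2 * p * c / (1 + p ^ 2) := by field_simp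
  rw [hd, le_div_iff₀ (by positivity)]
  have h1 : 0 ≤ p ^ 5 * (1 + c) := mul_nonneg (by positivity) (by linarith)
  have h2 : 0 ≤ p ^ 7 * (1 - p ^ 2) := mul_nonneg (by positivity) (by nlinarith)
  linarith [h1, h2]

/-- A function vanishing at infinity whose derivative is at most `2 cos x * coshLog x`
on `[0, ∞)`. -/
noncomputable def minorantPrimitive (x : ℝ) : ℝ :=
  coshLogDeriv x * Real.cos x + coshLog x * Real.sin x
    + Real.exp (-x) * (Real.sin x - Real.cos x)
    - 1 / 5 * (Real.exp (-3 * x) * (Real.sin x - 3 * Real.cos x))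
    + 2 / 5 * Real.exp (-5 * x) - 1 / 7 * Real.exp (-7 * x)

lemma hasDerivAt_minorantPrimitive (x : ℝ) :
    HasDerivAt minorantPrimitive
      (2 * (Real.cos x * coshLog x) - Real.cos x * (1 / Real.cosh x)
        + (2 * Real.exp (-x) * Real.cos x - 2 * Real.exp (-3 * x) * Real.cos x
          - 2 * Real.exp (-5 * x) + Real.exp (-7 * x))) x := by
  have hs := Real.hasDerivAt_sin x
  have hc := Real.hasDerivAt_cos x
  have he (k : ℝ) : HasDerivAt (fun x => Real.exp (k * x)) (Real.exp (k * x) * (k * 1)) x :=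
    ((hasDerivAt_id x).const_mul k).exp
  have h := ((((((hasDerivAt_coshLogDeriv x).mul hc).add ((hasDerivAt_coshLog x).mul hs)).add
    ((hasDerivAt_neg x).exp.mul (hs.sub hc))).sub
    (((he (-3)).mul (hs.sub (hc.const_mul 3))).const_mul (1 / 5))).add
    ((he (-5)).const_mul (2 / 5))).sub ((he (-7)).const_mul (1 / 7))
  refine h.congr_deriv ?_
  simp only [Pi.sub_apply]
  ring

lemma minorantPrimitive_zero : minorantPrimitive 0 = -(1 / 7) := by
  simp [minorantPrimitive, coshLogDeriv]
  norm_num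

lemma neg_exp_le_minorantPrimitive {x : ℝ} (hx : 0 ≤ x) :
    -(10 * Real.exp (-(1 / 2) * x)) ≤ minorantPrimitive x := by
  have hmul {a b : ℝ} (hb : |b| ≤ 1) : -|a| ≤ a * b := by
    have := mul_le_mul_of_nonneg_left hb (abs_nonneg a)
    rw [← abs_mul] at this
    linarith [neg_abs_le (a * b)]
  have h1 := hmul (a := coshLogDeriv x) (Real.abs_cos_le_one x)
  have h2 := hmul (a := coshLog x) (Real.abs_sin_le_one x)
  have h3 := abs_coshLogDeriv_le hx
  have h4 := abs_coshLog_le hx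
  have e1 : Real.exp (-x) ≤ Real.exp (-(1 / 2) * x) := Real.exp_le_exp.2 (by linarith)
  have e3 : Real.exp (-3 * x) ≤ Real.exp (-(1 / 2) * x) := Real.exp_le_exp.2 (by linarith)
  have e7 : Real.exp (-7 * x) ≤ Real.exp (-(1 / 2) * x) := Real.exp_le_exp.2 (by linarith)
  have h5 : Real.exp (-x) * (-2) ≤ Real.exp (-x) * (Real.sin x - Real.cos x) :=
    mul_le_mul_of_nonneg_left (by linarith [Real.neg_one_le_sin x, Real.cos_le_one x])
      (Real.exp_pos _).le
  have h6 : Real.exp (-3 * x) * (Real.sin x - 3 * Real.cos x) ≤ Real.exp (-3 * x) * 4 :=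
    mul_le_mul_of_nonneg_left (by linarith [Real.sin_le_one x, Real.neg_one_le_cos x])
      (Real.exp_pos _).le
  rw [minorantPrimitive]
  linarith [Real.exp_pos (-5 * x), Real.exp_pos (-(1 / 2) * x)]

lemma integral_Ioi_cos_mul_coshLog_pos :
    0 < ∫ x in Ioi (0 : ℝ), Real.cos x * coshLog x := by
  have hcont : Continuous fun x => 2 * (Real.cos x * coshLog x) :=
    continuous_const.mul (Real.continuous_cos.mul continuous_coshLog)
  have hle : ∀ R : ℝ, 0 ≤ R → 1 / 7 - 10 * Real.exp (-(1 / 2) * R) ≤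
      ∫ x in (0 : ℝ)..R, 2 * (Real.cos x * coshLog x) := fun R hR => by
    have h := intervalIntegral.sub_le_integral_of_hasDeriv_right_of_le hR
      (fun x _ => (hasDerivAt_minorantPrimitive x).continuousAt.continuousWithinAt)
      (fun x _ => (hasDerivAt_minorantPrimitive x).hasDerivWithinAt)
      (hcont.continuousOn.integrableOn_Icc)
      (fun x hx => by linarith [le_cos_mul_one_div_cosh hx.1.le])
    rw [minorantPrimitive_zero] at h
    linarith [neg_exp_le_minorantPrimitive hR]
  have hlim := intervalIntegral_tendsto_integral_Ioi 0
    (integrable_cos_mul_coshLog.const_mul 2).integrableOn tendsto_id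
  have hexp : Tendsto (fun R : ℝ => 1 / 7 - 10 * Real.exp (-(1 / 2) * R)) atTop
      (𝓝 (1 / 7 - 10 * 0)) :=
    ((Real.tendsto_exp_atBot.comp
      (tendsto_id.const_mul_atTop_of_neg (by norm_num))).const_mul 10).const_sub _
  have h := le_of_tendsto_of_tendsto hexp hlim
    ((eventually_ge_atTop 0).mono fun R hR => hle R hR)
  rw [integral_const_mul] at h
  linarith

/-- the function `x ↦ cos(x)(x tanh(x) − log(eˣ+e⁻ˣ)) cosh(x)` is
integrable on `ℝ` and its integral is strictly negative. -/
theorem stmt_18 :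
    Integrable (fun x : ℝ =>
      Real.cos x * (x * Real.tanh x - Real.log (Real.exp x + Real.exp (-x))) *
        Real.cosh x) (volume : Measure ℝ) ∧
    (∫ x : ℝ, Real.cos x * (x * Real.tanh x - Real.log (Real.exp x + Real.exp (-x))) *
        Real.cosh x) < 0 := by
  simp only [integrand_eq_neg_cos_mul_coshLog]
  refine ⟨integrable_cos_mul_coshLog.neg, ?_⟩
  have h := integral_comp_abs (f := fun x => Real.cos x * coshLog x)
  simp only [Real.cos_abs, coshLog_abs] at h
  rw [integral_neg, h]
  linarith [integral_Ioi_cos_mul_coshLog_pos]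
end
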